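/- arXiv:math/9801101 — 4 statements merged into one kernel-verified Lean document; each statement's English description precedes it below -/
import Mathlib

section
/- Let A and B be ℤ_p[G]-modules that are finitely generated and free over ℤ_p, and let A ⊗_{ℤ_p} B carry the diagonal G-action. Then the Tate cohomology of the tensor product satisfies the Künneth formula: dim_{F_p} Ĥ⁰(g, A⊗B) = dim Ĥ⁰(g,A)·dim Ĥ⁰(g,B) + dim Ĥ¹(g,A)·dim Ĥ¹(g,B), and dim_{F_p} Ĥ¹(g, A⊗B) = dim Ĥ⁰(g,A)·dim Ĥ¹(g,B) + dim Ĥ¹(g,A)·dim Ĥ⁰(g,B). -/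
open scoped TensorProduct

set_option maxHeartbeats 1000000
set_option synthInstance.maxHeartbeats 400000

/-- The cyclic group of order `p`, written multiplicatively, with generator
`Multiplicative.ofAdd 1`. -/
abbrev Gp (p : ℕ) : Type := Multiplicative (ZMod p)

/-- The distinguished generator `g` of the cyclic group of order `p`. -/
def gen (p : ℕ) : Gp p := Multiplicative.ofAdd (1 : ZMod p)

/-- The norm element `N_G = 1 + g + ⋯ + g^{p-1}` acting on a representation. -/
noncomputable def normMap (p : ℕ) [Fact p.Prime] {V : Type*} [AddCommGroup V]
    [Module ℤ_[p] V] (ρ : Representation ℤ_[p] (Gp p) V) : V →ₗ[ℤ_[p]] V :=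
  ∑ g : Gp p, (ρ g)

/-- The Tate cohomology group `Ĥ⁰(g, V) = V^G / N_G·V`. -/
noncomputable def TateH0 (p : ℕ) [Fact p.Prime] {V : Type*} [AddCommGroup V]
    [Module ℤ_[p] V] (ρ : Representation ℤ_[p] (Gp p) V) : Type _ :=
  ρ.invariants ⧸
    (Submodule.comap ρ.invariants.subtype (LinearMap.range (normMap p ρ)))

/-- The Tate cohomology group `Ĥ¹(g, V) = ker N_G / (g − 1)·V`. -/
noncomputable def TateH1 (p : ℕ) [Fact p.Prime] {V : Type*} [AddCommGroup V]
    [Module ℤ_[p] V] (ρ : Representation ℤ_[p] (Gp p) V) : Type _ :=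
  LinearMap.ker (normMap p ρ) ⧸
    (Submodule.comap (LinearMap.ker (normMap p ρ)).subtype
      (LinearMap.range (ρ (gen p) - LinearMap.id)))


namespace TK

set_option linter.all false
set_option linter.unusedSimpArgs false

open Finset

section homotopy

variable {R M : Type*} [CommRing R] [IsDomain R] [IsPrincipalIdealRing R]
  [AddCommGroup M] [Module R M] [Module.Free R M] [Module.Finite R M]

lemma proj_sub (N : Submodule R M) : Module.Projective R N := by
  have := Submodule.nonempty_basis_of_pid (Module.Free.chooseBasis R M) N
  obtain ⟨n, ⟨b⟩⟩ := this
  exact Module.Projective.of_basis b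

lemma exists_homotopy (f0 f1 : Module.End R M) (h0 : LinearMap.ker f0 = LinearMap.range f1)
    (h1 : LinearMap.ker f1 = LinearMap.range f0) :
    ∃ s t : Module.End R M, f0 * s + t * f1 = 1 := by
  have := proj_sub (LinearMap.range f0)
  have := proj_sub (LinearMap.range f1)
  obtain ⟨σ, hσ⟩ := LinearMap.exists_rightInverse_of_surjective f1.rangeRestrict
    (LinearMap.range_rangeRestrict f1)
  obtain ⟨τ, hτ⟩ := LinearMap.exists_rightInverse_of_surjective f0.rangeRestrict
    (LinearMap.range_rangeRestrict f0)
  have hσ' : ∀ z, f1 (σ z) = z := fun z => congrArg Subtype.val (LinearMap.congr_fun hσ z)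
  have hτ' : ∀ z, f0 (τ z) = z := fun z => congrArg Subtype.val (LinearMap.congr_fun hτ z)
  let r : M →ₗ[R] LinearMap.range f1 :=
    LinearMap.codRestrict _ (LinearMap.id - τ ∘ₗ f0.rangeRestrict) (by
      intro m
      rw [← h0, LinearMap.mem_ker]
      simp [hτ'])
  have hr : ∀ m, r (f1 m) = ⟨f1 m, m, rfl⟩ := by
    intro m
    apply Subtype.ext
    have : f0.rangeRestrict (f1 m) = 0 := by
      apply Subtype.ext
      have : f1 m ∈ LinearMap.ker f0 := by rw [h0]; exact ⟨m, rfl⟩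
      simpa using this
    simp [r, this]
  let t : Module.End R M := σ ∘ₗ r
  let q : M →ₗ[R] LinearMap.range f0 := LinearMap.codRestrict _ (LinearMap.id - t ∘ₗ f1) (by
      intro m
      rw [← h1, LinearMap.mem_ker]
      simp [t, hr, hσ'])
  refine ⟨τ ∘ₗ q, t, ?_⟩
  ext m
  simp [hτ', q]

end homotopy

section perturb
variable {p : ℕ} [Fact p.Prime] {M : Type*} [AddCommGroup M] [Module ℤ_[p] M]
  [Module.Free ℤ_[p] M] [Module.Finite ℤ_[p] M]

lemma perturb (e0 e1 s t ε η : Module.End ℤ_[p] M) (h10 : e1 * e0 = 0)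
    (h : e0 * s + t * e1 = 1 + ε) (n : ℕ) (hε : ε ^ n = (p : ℤ_[p]) • η) :
    LinearMap.ker e1 ≤ LinearMap.range e0 := by
  have h10' : ∀ x, e1 (e0 x) = 0 := fun x => LinearMap.congr_fun h10 x
  have hh : ∀ x, e1 x = 0 → ε x = e0 (s x) - x := by
    intro x hx
    have := LinearMap.congr_fun h x
    simp [hx] at this
    rw [this]; abel
  have key : ∀ k : ℕ, ∀ x, e1 x = 0 → e1 ((ε ^ k) x) = 0 ∧
      ∃ z, x = e0 z + (-1 : ℤ_[p]) ^ k • (ε ^ k) x := by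
    intro k
    induction k with
    | zero => intro x hx; exact ⟨by simpa using hx, 0, by simp⟩
    | succ k ih =>
      intro x hx
      obtain ⟨h1, z, hz⟩ := ih x hx
      have h2 := hh _ h1
      rw [pow_succ', Module.End.mul_apply, h2]
      refine ⟨by simp [h10', h1], z + (-1 : ℤ_[p]) ^ k • s ((ε ^ k) x), ?_⟩
      conv_lhs => rw [hz]
      rw [pow_succ, map_add, map_smul, mul_neg_one, neg_smul, smul_sub]
      abel
  apply Submodule.le_of_le_smul_of_le_jacobson_bot (I := Ideal.span {(p : ℤ_[p])})
  · exact IsNoetherian.noetherian _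
  · rw [← PadicInt.maximalIdeal_eq_span_p]
    exact IsLocalRing.maximalIdeal_le_jacobson _
  · intro x hx
    obtain ⟨h1, z, hz⟩ := key n x hx
    rw [hε] at h1 hz
    rw [hz]
    refine Submodule.add_mem_sup ⟨z, rfl⟩ ?_
    rw [LinearMap.smul_apply, smul_comm]
    apply Submodule.smul_mem_smul (Ideal.mem_span_singleton_self _)
    rw [LinearMap.smul_apply, map_smul] at h1
    have hp : (p : ℤ_[p]) ≠ 0 := by exact_mod_cast (Fact.out : p.Prime).ne_zero
    have := (smul_eq_zero.1 h1).resolve_left hp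
    simp [this]
end perturb

section rel
variable {R M B : Type*} [CommRing R] [AddCommGroup M] [Module R M] [AddCommGroup B] [Module R B]

def Rel (S : Module.End R B) (e : Module.End R (M ⊗[R] B)) (f : Module.End R M) : Prop :=
  ∃ q : Module.End R (M ⊗[R] B), Commute q (LinearMap.lTensor M (S - 1)) ∧
    e = LinearMap.rTensor B f + q * LinearMap.lTensor M (S - 1)

variable {S : Module.End R B}

lemma comm_lr (f : Module.End R M) (g : Module.End R B) :
    Commute (LinearMap.rTensor B f : Module.End R (M ⊗[R] B)) (LinearMap.lTensor M g) := by
  change LinearMap.rTensor B f ∘ₗ LinearMap.lTensor M g = LinearMap.lTensor M g ∘ₗ LinearMap.rTensor B f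
  rw [LinearMap.rTensor_comp_lTensor, LinearMap.lTensor_comp_rTensor]

lemma Rel.add {e e' : Module.End R (M ⊗[R] B)} {f f' : Module.End R M}
    (h : Rel S e f) (h' : Rel S e' f') : Rel S (e + e') (f + f') := by
  obtain ⟨q, hq, rfl⟩ := h
  obtain ⟨q', hq', rfl⟩ := h'
  refine ⟨q + q', hq.add_left hq', ?_⟩
  rw [LinearMap.rTensor_add]; noncomm_ring

lemma Rel.neg {e : Module.End R (M ⊗[R] B)} {f : Module.End R M}
    (h : Rel S e f) : Rel S (-e) (-f) := by
  obtain ⟨q, hq, rfl⟩ := h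
  refine ⟨-q, hq.neg_left, ?_⟩
  rw [LinearMap.rTensor_neg, neg_add]
  congr 1

lemma Rel.sub {e e' : Module.End R (M ⊗[R] B)} {f f' : Module.End R M}
    (h : Rel S e f) (h' : Rel S e' f') : Rel S (e - e') (f - f') := by
  rw [sub_eq_add_neg, sub_eq_add_neg]; exact h.add h'.neg

lemma Rel.mul {e e' : Module.End R (M ⊗[R] B)} {f f' : Module.End R M}
    (h : Rel S e f) (h' : Rel S e' f') : Rel S (e * e') (f * f') := by
  obtain ⟨q, hq, rfl⟩ := h
  obtain ⟨q', hq', rfl⟩ := h'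
  have hf := comm_lr f (S - 1)
  have hf' := comm_lr f' (S - 1)
  rw [Rel, LinearMap.rTensor_mul]
  generalize (LinearMap.rTensor B f : Module.End R (M ⊗[R] B)) = F at *
  generalize (LinearMap.rTensor B f' : Module.End R (M ⊗[R] B)) = F' at *
  generalize (LinearMap.lTensor M (S - 1) : Module.End R (M ⊗[R] B)) = U at *
  refine ⟨F * q' + q * F' + q * U * q', ?_, ?_⟩
  · exact ((hf.mul_left hq').add_left (hq.mul_left hf')).add_left
      ((hq.mul_left (Commute.refl U)).mul_left hq')
  · have : q * U * F' = q * F' * U := by rw [mul_assoc, ← hf'.eq, mul_assoc]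
    rw [add_mul, mul_add, mul_add, this]; noncomm_ring

lemma Rel.rT (f : Module.End R M) : Rel S (LinearMap.rTensor B f) f :=
  ⟨0, Commute.zero_left _, by simp⟩

lemma Rel.one : Rel S (1 : Module.End R (M ⊗[R] B)) 1 :=
  ⟨0, Commute.zero_left _, by rw [zero_mul, add_zero]; exact (LinearMap.rTensor_id _ _).symm⟩

lemma Rel.zero : Rel S (0 : Module.End R (M ⊗[R] B)) 0 :=
  ⟨0, Commute.zero_left _, by simp⟩

lemma Rel.lT : Rel S (LinearMap.lTensor M S : Module.End R (M ⊗[R] B)) 1 := by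
  refine ⟨1, Commute.one_left _, ?_⟩
  rw [LinearMap.lTensor_sub, one_mul]
  have h1 : (LinearMap.rTensor B (1 : Module.End R M)) = (1 : Module.End R (M ⊗[R] B)) :=
    LinearMap.rTensor_id _ _
  have h2 : (LinearMap.lTensor M (1 : Module.End R B)) = (1 : Module.End R (M ⊗[R] B)) :=
    LinearMap.lTensor_id _ _
  rw [h1, h2]; abel

lemma Rel.map (f : Module.End R M) (k : ℕ) :
    Rel S (TensorProduct.map f (S ^ k)) f := by
  rw [← LinearMap.rTensor_comp_lTensor, ← LinearMap.lTensor_pow]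
  have : ∀ k, Rel S ((LinearMap.lTensor M S : Module.End R (M ⊗[R] B)) ^ k) 1 := by
    intro k
    induction k with
    | zero => simpa using Rel.one
    | succ k ih => rw [pow_succ]; simpa using ih.mul Rel.lT
  have h := (Rel.rT (S := S) (B := B) f).mul (this k)
  rwa [mul_one] at h

lemma Rel.sum {ι : Type*} (s : Finset ι) {e : ι → Module.End R (M ⊗[R] B)}
    {f : ι → Module.End R M} (h : ∀ i ∈ s, Rel S (e i) (f i)) :
    Rel S (∑ i ∈ s, e i) (∑ i ∈ s, f i) := by
  classical
  induction s using Finset.induction_on with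
  | empty => simpa using Rel.zero
  | insert a s ha ih =>
    rw [Finset.sum_insert ha, Finset.sum_insert ha]
    exact (h a (by simp)).add (ih fun i hi => h i (by simp [hi]))

lemma pow_prime_sub {E : Type*} [Ring E] (p : ℕ) (hp : p.Prime) (S : E) (hS : S ^ p = 1) :
    ∃ q : E, (S - 1) ^ p = (p : E) * q := by
  have := (Commute.one_right (S - 1)).add_pow_prime_eq hp
  rw [sub_add_cancel, hS, one_pow] at this
  refine ⟨-((S - 1) * 1 * ∑ k ∈ Finset.Ioo 0 p, (S - 1) ^ (k - 1) * 1 ^ (p - k - 1) * ↑(p.choose k / p)), ?_⟩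
  rw [mul_neg, ← mul_assoc, ← mul_assoc]
  have h2 := sub_eq_zero.2 this
  rw [eq_neg_iff_add_eq_zero, ← neg_eq_zero, ← h2]
  abel

end rel

section tens
variable {p : ℕ} [Fact p.Prime] {M B : Type*} [AddCommGroup M] [Module ℤ_[p] M]
  [Module.Free ℤ_[p] M] [Module.Finite ℤ_[p] M] [AddCommGroup B] [Module ℤ_[p] B]
  [Module.Free ℤ_[p] B] [Module.Finite ℤ_[p] B]

lemma tensor_acyclic (S : Module.End ℤ_[p] B) (hS : S ^ p = 1)
    (e0 e1 : Module.End ℤ_[p] (M ⊗[ℤ_[p]] B)) (f0 f1 : Module.End ℤ_[p] M)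
    (r0 : Rel S e0 f0) (r1 : Rel S e1 f1) (h0 : LinearMap.ker f0 = LinearMap.range f1)
    (h1 : LinearMap.ker f1 = LinearMap.range f0) (h10 : e1 * e0 = 0) :
    LinearMap.ker e1 ≤ LinearMap.range e0 := by
  obtain ⟨s, t, hst⟩ := exists_homotopy f0 f1 h0 h1
  have r := ((r0.mul (Rel.rT s)).add ((Rel.rT t).mul r1)).sub Rel.one
  rw [hst, sub_self] at r
  obtain ⟨q, hq, hqe⟩ := r
  rw [LinearMap.rTensor_zero, zero_add] at hqe
  obtain ⟨w, hw⟩ := pow_prime_sub p Fact.out S hS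
  refine perturb e0 e1 (LinearMap.rTensor B s) (LinearMap.rTensor B t)
    (q * LinearMap.lTensor M (S - 1)) (q ^ p * LinearMap.lTensor M w) h10 ?_ p ?_
  · rw [← hqe]; abel
  · rw [hq.mul_pow, LinearMap.lTensor_pow, hw]
    have : (p : Module.End ℤ_[p] B) * w = (p : ℤ_[p]) • w := by
      rw [← nsmul_eq_mul, Nat.cast_smul_eq_nsmul]
    rw [this, LinearMap.lTensor_smul, mul_smul_comm]
end tens

section cone
variable {R A B : Type*} [CommRing R] [AddCommGroup A] [Module R A] [AddCommGroup B] [Module R B]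

def nm (p : ℕ) (T : Module.End R A) : Module.End R A := ∑ k ∈ range p, T ^ k

lemma nm_apply (p : ℕ) (T : Module.End R A) (v : A) : nm p T v = ∑ k ∈ range p, (T ^ k) v := by
  simp [nm]

lemma nm_D (p : ℕ) {T : Module.End R A} (hT : T ^ p = 1) (v : A) :
    nm p T (T v - v) = 0 := by
  have := LinearMap.congr_fun (geom_sum_mul T p) v
  rw [hT, sub_self] at this
  simpa [nm] using this

lemma D_nm (p : ℕ) {T : Module.End R A} (hT : T ^ p = 1) (v : A) :
    T (nm p T v) - nm p T v = 0 := by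
  have := LinearMap.congr_fun (mul_geom_sum T p) v
  rw [hT, sub_self] at this
  simpa [nm] using this

/-- the degree-one cup product -/
noncomputable def cup (p : ℕ) (T : Module.End R A) (S : Module.End R B) (y : A) : B →ₗ[R] A ⊗[R] B :=
  ∑ k ∈ range p, TensorProduct.mk R A B ((T ^ k) y) ∘ₗ nm k S

lemma cup_apply (p : ℕ) (T : Module.End R A) (S : Module.End R B) (y : A) (β : B) :
    cup p T S y β = ∑ k ∈ range p, (T ^ k) y ⊗ₜ[R] nm k S β := by
  simp [cup]

lemma nm_tmul (p : ℕ) (T : Module.End R A) (S : Module.End R B) (y : A) (β : B) :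
    nm p (TensorProduct.map T S) (y ⊗ₜ β) = ∑ k ∈ range p, (T ^ k) y ⊗ₜ[R] (S ^ k) β := by
  simp [nm_apply, TensorProduct.map_pow]

lemma cup_D (p : ℕ) (T : Module.End R A) (S : Module.End R B) (y : A)
    (hy : nm p T y = 0) (β : B) :
    cup p T S y (S β - β) = nm p (TensorProduct.map T S) (y ⊗ₜ β) := by
  rw [cup_apply, nm_tmul]
  have h : ∀ k, nm k S (S β - β) = (S ^ k) β - β := by
    intro k
    have := LinearMap.congr_fun (geom_sum_mul S k) β
    simpa [nm] using this
  simp_rw [h, TensorProduct.tmul_sub, Finset.sum_sub_distrib, ← TensorProduct.sum_tmul,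
    ← nm_apply, hy, TensorProduct.zero_tmul, sub_zero]

lemma D_cup (p : ℕ) (T : Module.End R A) (hT : T ^ p = 1) (S : Module.End R B) (y : A)
    (hy : nm p T y = 0) (β : B) :
    TensorProduct.map T S (cup p T S y β) - cup p T S y β = y ⊗ₜ nm p S β := by
  rw [cup_apply, map_sum]
  have h : ∀ k, TensorProduct.map T S ((T ^ k) y ⊗ₜ[R] nm k S β) =
      (T ^ (k+1)) y ⊗ₜ[R] nm (k+1) S β - T ((T ^ k) y) ⊗ₜ β := by
    intro k
    rw [TensorProduct.map_tmul, pow_succ', Module.End.mul_apply, ← TensorProduct.tmul_sub]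
    congr 1
    rw [nm_apply, nm_apply, Finset.sum_range_succ', map_sum]
    simp [pow_succ']
  simp_rw [h]
  rw [Finset.sum_sub_distrib, ← TensorProduct.sum_tmul, ← map_sum, ← nm_apply, hy, map_zero,
    TensorProduct.zero_tmul, sub_zero, ← Finset.sum_sub_distrib,
    Finset.sum_range_sub (fun k => (T ^ k) y ⊗ₜ[R] nm k S β)]
  simp [hT, nm]

variable {a b : ℕ} (p : ℕ) (T : Module.End R A) (S : Module.End R B) (x : Fin a → A) (y : Fin b → A)

noncomputable def lin (x : Fin a → A) : (Fin a → B) →ₗ[R] A ⊗[R] B :=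
  ∑ i, TensorProduct.mk R A B (x i) ∘ₗ LinearMap.proj i

noncomputable def lcup : (Fin b → B) →ₗ[R] A ⊗[R] B :=
  ∑ j, cup p T S (y j) ∘ₗ LinearMap.proj j

lemma lin_apply (β : Fin a → B) : lin (R := R) x β = ∑ i, x i ⊗ₜ β i := by simp [lin]
lemma lcup_apply (β : Fin b → B) : lcup p T S y β = ∑ j, cup p T S (y j) (β j) := by simp [lcup]

noncomputable def E0 : Module.End R ((A ⊗[R] B) × (Fin a → B) × (Fin b → B)) where
  toFun m := (TensorProduct.map T S m.1 - m.1 + lin x m.2.1 + lin y m.2.2,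
    -(nm p S).compLeft (Fin a) m.2.1, -((S - 1).compLeft (Fin b) m.2.2))
  map_add' m n := by
    ext <;> simp <;> abel
  map_smul' c m := by
    ext <;> simp [smul_add, smul_sub]

noncomputable def E1 : Module.End R ((A ⊗[R] B) × (Fin a → B) × (Fin b → B)) where
  toFun m := (nm p (TensorProduct.map T S) m.1 + lin x m.2.1 + lcup p T S y m.2.2,
    -((S - 1).compLeft (Fin a) m.2.1), -((nm p S).compLeft (Fin b) m.2.2))
  map_add' m n := by
    ext <;> simp <;> abel
  map_smul' c m := by
    ext <;> simp [smul_add, smul_sub]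

lemma E0_apply (m) : E0 p T S x y m = (TensorProduct.map T S m.1 - m.1 + lin x m.2.1 + lin y m.2.2,
    -(nm p S).compLeft (Fin a) m.2.1, -((S - 1).compLeft (Fin b) m.2.2)) := rfl
lemma E1_apply (m) : E1 p T S x y m =
   (nm p (TensorProduct.map T S) m.1 + lin x m.2.1 + lcup p T S y m.2.2,
    -((S - 1).compLeft (Fin a) m.2.1), -((nm p S).compLeft (Fin b) m.2.2)) := rfl

lemma map_pow_one (hT : T ^ p = 1) (hS : S ^ p = 1) : (TensorProduct.map T S) ^ p = 1 := by
  rw [TensorProduct.map_pow, hT, hS]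
  exact TensorProduct.map_id

/- chain map identities -/
lemma D_lin (hx : ∀ i, T (x i) = x i) (β : Fin a → B) :
    TensorProduct.map T S (lin x β) - lin x β = lin x (fun i => S (β i) - β i) := by
  simp [lin_apply, hx, TensorProduct.tmul_sub, Finset.sum_sub_distrib]

lemma pow_fix {v : A} (hv : T v = v) (k : ℕ) : (T ^ k) v = v := by
  induction k with
  | zero => simp
  | succ k ih => rw [pow_succ', Module.End.mul_apply, ih, hv]

lemma nm_lin (hx : ∀ i, T (x i) = x i) (β : Fin a → B) :
    nm p (TensorProduct.map T S) (lin x β) = lin x (fun i => nm p S (β i)) := by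
  rw [lin_apply, lin_apply, map_sum]
  refine Finset.sum_congr rfl fun i _ => ?_
  rw [nm_tmul, nm_apply, TensorProduct.tmul_sum]
  simp [pow_fix T (hx i)]

lemma D_lcup (hT : T ^ p = 1) (hy : ∀ j, nm p T (y j) = 0) (γ : Fin b → B) :
    TensorProduct.map T S (lcup p T S y γ) - lcup p T S y γ = lin y (fun i => nm p S (γ i)) := by
  rw [lcup_apply, lin_apply, map_sum, ← Finset.sum_sub_distrib]
  exact Finset.sum_congr rfl fun i _ => D_cup p T hT S _ (hy i) _

lemma nm_lin_y (hy : ∀ j, nm p T (y j) = 0) (γ : Fin b → B) :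
    nm p (TensorProduct.map T S) (lin y γ) = lcup p T S y (fun i => S (γ i) - γ i) := by
  rw [lcup_apply, lin_apply, map_sum]
  exact Finset.sum_congr rfl fun i _ => (cup_D p T S _ (hy i) _).symm

variable (hT : T ^ p = 1) (hS : S ^ p = 1) (hx : ∀ i, T (x i) = x i) (hy : ∀ j, nm p T (y j) = 0)

include hT hS hx hy in
lemma E1E0 : E1 p T S x y * E0 p T S x y = 0 := by
  apply LinearMap.ext
  intro m
  rw [Module.End.mul_apply, E0_apply, E1_apply, LinearMap.zero_apply]
  refine Prod.ext ?_ (Prod.ext ?_ ?_)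
  · simp only [map_add, map_neg, nm_D p (map_pow_one p T S hT hS), nm_lin p T S x hx,
      nm_lin_y p T S y hy]
    simp only [LinearMap.compLeft, LinearMap.coe_mk, AddHom.coe_mk, Function.comp_def,
      LinearMap.sub_apply, Module.End.one_apply, Prod.fst_zero]
    abel
  · ext i
    have := D_nm p hS (m.2.1 i)
    simp [sub_eq_zero] at this ⊢
    simp [this]
  · ext i
    have := nm_D p hS (m.2.2 i)
    simp [sub_eq_zero] at this ⊢
    simp [this]

include hT hS hx hy in
lemma E0E1 : E0 p T S x y * E1 p T S x y = 0 := by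
  apply LinearMap.ext
  intro m
  rw [Module.End.mul_apply, E0_apply, E1_apply, LinearMap.zero_apply]
  refine Prod.ext ?_ (Prod.ext ?_ ?_)
  · have h1 := D_nm p (map_pow_one p T S hT hS) m.1
    have h2 := D_lin T S x hx m.2.1
    have h3 := D_lcup p T S y hT hy m.2.2
    simp only [map_add, map_neg]
    simp only [LinearMap.compLeft, LinearMap.coe_mk, AddHom.coe_mk, Function.comp_def,
      LinearMap.sub_apply, Module.End.one_apply, Prod.fst_zero]
    rw [← h2, ← h3]
    rw [sub_eq_zero] at h1
    rw [h1]
    abel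
  · ext i
    have := nm_D p hS (m.2.1 i)
    simp [sub_eq_zero] at this ⊢
    simp [this]
  · ext i
    have := D_nm p hS (m.2.2 i)
    simp [sub_eq_zero] at this ⊢
    simp [this]

noncomputable def cEq (ι : Type) [Fintype ι] [DecidableEq ι] : ((ι → R) ⊗[R] B) ≃ₗ[R] (ι → B) :=
  TensorProduct.comm R _ _ ≪≫ₗ TensorProduct.piScalarRight R R B ι

noncomputable def EE : ((A × (Fin a → R) × (Fin b → R)) ⊗[R] B) ≃ₗ[R]
    ((A ⊗[R] B) × (Fin a → B) × (Fin b → B)) :=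
  TensorProduct.prodLeft R R _ _ _ ≪≫ₗ
    LinearEquiv.prodCongr (LinearEquiv.refl R _) (TensorProduct.prodLeft R R _ _ _ ≪≫ₗ
      LinearEquiv.prodCongr (cEq _) (cEq _))

lemma EE_tmul (m : A × (Fin a → R) × (Fin b → R)) (v : B) :
    EE (m ⊗ₜ v) = (m.1 ⊗ₜ v, fun i => m.2.1 i • v, fun i => m.2.2 i • v) := by
  obtain ⟨m1, m2, m3⟩ := m
  refine Prod.ext ?_ (Prod.ext ?_ ?_)
  · simp [EE]
  · ext i; simp [EE, cEq]
  · ext i; simp [EE, cEq]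

abbrev M0 (R A : Type*) [CommRing R] (a b : ℕ) := A × (Fin a → R) × (Fin b → R)

noncomputable def iA (f : Module.End R A) : Module.End R (M0 R A a b) :=
  LinearMap.inl R A _ ∘ₗ f ∘ₗ LinearMap.fst R A _
noncomputable def iX (x : Fin a → A) : Module.End R (M0 R A a b) :=
  LinearMap.inl R A _ ∘ₗ Fintype.linearCombination R x ∘ₗ LinearMap.fst R _ _ ∘ₗ LinearMap.snd R A _
noncomputable def iY (y : Fin b → A) : Module.End R (M0 R A a b) :=
  LinearMap.inl R A _ ∘ₗ Fintype.linearCombination R y ∘ₗ LinearMap.snd R _ _ ∘ₗ LinearMap.snd R A _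
noncomputable def iP : Module.End R (M0 R A a b) :=
  LinearMap.inr R A _ ∘ₗ LinearMap.inl R _ _ ∘ₗ LinearMap.fst R _ _ ∘ₗ LinearMap.snd R A _
noncomputable def iQ : Module.End R (M0 R A a b) :=
  LinearMap.inr R A _ ∘ₗ LinearMap.inr R _ _ ∘ₗ LinearMap.snd R _ _ ∘ₗ LinearMap.snd R A _

lemma iA_apply (f : Module.End R A) (m : M0 R A a b) : iA f m = (f m.1, 0, 0) := rfl
lemma iX_apply (m : M0 R A a b) : iX x m = (∑ i, m.2.1 i • x i, 0, 0) := rfl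
lemma iY_apply (m : M0 R A a b) : iY y m = (∑ i, m.2.2 i • y i, 0, 0) := rfl
lemma iP_apply (m : M0 R A a b) : iP m = (0, m.2.1, 0) := rfl
lemma iQ_apply (m : M0 R A a b) : iQ m = (0, 0, m.2.2) := rfl

noncomputable def f0 : Module.End R (M0 R A a b) :=
  iA T - iA 1 + iX x + iY y - ∑ _k ∈ range p, iP - (iQ - iQ)
noncomputable def f1 : Module.End R (M0 R A a b) :=
  ∑ k ∈ range p, iA (T ^ k) + iX x + ∑ k ∈ range p, ∑ _l ∈ range k, iY (fun j => (T ^ k) (y j))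
    - (iP - iP) - ∑ _k ∈ range p, iQ

noncomputable def e0 : Module.End R (M0 R A a b ⊗[R] B) :=
  TensorProduct.map (iA T) (S ^ 1) - TensorProduct.map (iA 1) (S ^ 0)
   + TensorProduct.map (iX x) (S ^ 0) + TensorProduct.map (iY y) (S ^ 0)
   - ∑ k ∈ range p, TensorProduct.map iP (S ^ k)
   - (TensorProduct.map iQ (S ^ 1) - TensorProduct.map iQ (S ^ 0))
noncomputable def e1 : Module.End R (M0 R A a b ⊗[R] B) :=
  ∑ k ∈ range p, TensorProduct.map (iA (T ^ k)) (S ^ k)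
   + TensorProduct.map (iX x) (S ^ 0)
   + ∑ k ∈ range p, ∑ l ∈ range k, TensorProduct.map (iY (fun j => (T ^ k) (y j))) (S ^ l)
   - (TensorProduct.map iP (S ^ 1) - TensorProduct.map iP (S ^ 0))
   - ∑ k ∈ range p, TensorProduct.map iQ (S ^ k)

lemma rel0 : Rel S (e0 p T S x y) (f0 p T x y) := by
  unfold e0 f0
  exact (((((Rel.map _ _).sub (Rel.map _ _)).add (Rel.map _ _)).add (Rel.map _ _)).sub
    (Rel.sum _ fun _ _ => Rel.map _ _)).sub ((Rel.map _ _).sub (Rel.map _ _))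

lemma rel1 : Rel S (e1 p T S x y) (f1 p T x y) := by
  unfold e1 f1
  exact ((((Rel.sum _ fun _ _ => Rel.map _ _).add (Rel.map _ _)).add (Rel.sum _ fun _ _ =>
    Rel.sum _ fun _ _ => Rel.map _ _)).sub ((Rel.map _ _).sub (Rel.map _ _))).sub
    (Rel.sum _ fun _ _ => Rel.map _ _)

lemma EE_e0 (m) : EE (e0 p T S x y m) = E0 p T S x y (EE m) := by
  have : EE.toLinearMap ∘ₗ e0 p T S x y = E0 p T S x y ∘ₗ EE.toLinearMap := by
    apply TensorProduct.ext'
    intro m v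
    simp only [LinearMap.comp_apply, LinearEquiv.coe_coe, EE_tmul, E0_apply]
    refine Prod.ext ?_ (Prod.ext ?_ ?_)
    · simp [e0, EE_tmul, iA_apply, iX_apply, iY_apply, iP_apply, iQ_apply, lin_apply,
        TensorProduct.sum_tmul, TensorProduct.smul_tmul, Prod.fst_sum, Prod.snd_sum]
    · ext i
      simp [e0, EE_tmul, iA_apply, iX_apply, iY_apply, iP_apply, iQ_apply, nm_apply,
         Prod.fst_sum, Prod.snd_sum, Finset.smul_sum, smul_sub]
    · ext i
      simp [e0, EE_tmul, iA_apply, iX_apply, iY_apply, iP_apply, iQ_apply, nm_apply,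
         Prod.fst_sum, Prod.snd_sum, Finset.smul_sum, smul_sub]
  exact LinearMap.congr_fun this m

lemma EE_e1 (m) : EE (e1 p T S x y m) = E1 p T S x y (EE m) := by
  have : EE.toLinearMap ∘ₗ e1 p T S x y = E1 p T S x y ∘ₗ EE.toLinearMap := by
    apply TensorProduct.ext'
    intro m v
    simp only [LinearMap.comp_apply, LinearEquiv.coe_coe, EE_tmul, E1_apply]
    refine Prod.ext ?_ (Prod.ext ?_ ?_)
    · simp [e1, EE_tmul, iA_apply, iX_apply, iY_apply, iP_apply, iQ_apply, lin_apply, nm_tmul,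
        lcup_apply, cup_apply, 
        TensorProduct.sum_tmul, TensorProduct.smul_tmul, Prod.fst_sum, Prod.snd_sum]
      simp_rw [Finset.smul_sum]
      rw [Finset.sum_comm (s := Finset.univ)]
      refine Finset.sum_congr rfl fun k _ => ?_
      simp only [nm_apply, TensorProduct.tmul_sum, Finset.smul_sum]
      rw [Finset.sum_comm]
    · ext i
      simp [e1, EE_tmul, iA_apply, iX_apply, iY_apply, iP_apply, iQ_apply, nm_apply,
         Prod.fst_sum, Prod.snd_sum, Finset.smul_sum, smul_sub]
    · ext i
      simp [e1, EE_tmul, iA_apply, iX_apply, iY_apply, iP_apply, iQ_apply, nm_apply,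
         Prod.fst_sum, Prod.snd_sum, Finset.smul_sum, smul_sub]
  exact LinearMap.congr_fun this m

end cone

section exactness
variable {p : ℕ} [Fact p.Prime] {A : Type*} [AddCommGroup A] [Module ℤ_[p] A]

lemma zmod_basis (H : Type*) [AddCommGroup H] [Module (ZMod p) H] (a : ℕ)
    (hc : Nat.card H = p ^ a) : Nonempty (Module.Basis (Fin a) (ZMod p) H) := by
  have hpp : p.Prime := Fact.out
  have hfin : Finite H := Nat.finite_of_card_ne_zero (by
    rw [hc]; exact pow_ne_zero _ hpp.ne_zero)
  let _ : Fintype H := Fintype.ofFinite H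
  have hfr : Module.finrank (ZMod p) H = a := by
    have := Module.card_eq_pow_finrank (K := ZMod p) (V := H)
    rw [ZMod.card, ← Nat.card_eq_fintype_card, hc] at this
    exact (Nat.pow_right_injective hpp.two_le this).symm
  exact ⟨(Module.finBasis (ZMod p) H).reindex (finCongr hfr)⟩

lemma padic_basis (H : Type*) [AddCommGroup H] [Module ℤ_[p] H] [Module (ZMod p) H] (a : ℕ)
    (hc : Nat.card H = p ^ a) (hpH : ∀ h : H, p • h = 0) :
    ∃ x : Fin a → H, (∀ v, ∃ β : Fin a → ℤ_[p], v = ∑ i, β i • x i) ∧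
      ∀ β : Fin a → ℤ_[p], ∑ i, β i • x i = 0 → ∀ i, ∃ c, β i = (p : ℤ_[p]) * c := by
  have hsm : ∀ (c : ℤ_[p]) (h : H), c • h = (PadicInt.toZMod c) • h := by
    intro c h
    obtain ⟨d, hd⟩ : ∃ d, c - ((PadicInt.toZMod c).val : ℤ_[p]) = p * d := by
      have : c - ((PadicInt.toZMod c).val : ℤ_[p]) ∈ RingHom.ker (PadicInt.toZMod (p := p)) := by
        rw [RingHom.mem_ker, map_sub, map_natCast, ZMod.natCast_zmod_val, sub_self]
      rw [PadicInt.ker_toZMod, PadicInt.maximalIdeal_eq_span_p, Ideal.mem_span_singleton] at this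
      exact this
    have h1 : c • h = ((PadicInt.toZMod c).val : ℤ_[p]) • h := by
      rw [← sub_eq_zero, ← sub_smul, hd, mul_comm, mul_smul, Nat.cast_smul_eq_nsmul, hpH, smul_zero]
    rw [h1, Nat.cast_smul_eq_nsmul]
    conv_rhs => rw [← ZMod.natCast_zmod_val (PadicInt.toZMod c), Nat.cast_smul_eq_nsmul]
  obtain ⟨bs⟩ := zmod_basis (p := p) H a hc
  refine ⟨fun i => bs i, ?_, ?_⟩
  · intro h
    refine ⟨fun i => ((bs.repr h i).val : ℤ_[p]), ?_⟩
    simp only [hsm, map_natCast, ZMod.natCast_zmod_val]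
    exact (bs.sum_repr h).symm
  · intro β h1 i
    simp only [hsm] at h1
    have h2 := Fintype.linearIndependent_iff.1 bs.linearIndependent _ h1 i
    have h3 : β i ∈ RingHom.ker (PadicInt.toZMod (p := p)) := h2
    rw [PadicInt.ker_toZMod, PadicInt.maximalIdeal_eq_span_p, Ideal.mem_span_singleton] at h3
    exact h3

lemma exists_basis (K W : Submodule ℤ_[p] A) (a : ℕ)
    (hc : Nat.card (K ⧸ Submodule.comap K.subtype W) = p ^ a)
    (hp : ∀ v ∈ K, (p : ℤ_[p]) • v ∈ W) :
    ∃ x : Fin a → A, (∀ i, x i ∈ K) ∧ (∀ v ∈ K, ∃ β : Fin a → ℤ_[p], v - ∑ i, β i • x i ∈ W) ∧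
      ∀ β : Fin a → ℤ_[p], ∑ i, β i • x i ∈ W → ∀ i, ∃ c, β i = (p : ℤ_[p]) * c := by
  have hpH : ∀ h : K ⧸ Submodule.comap K.subtype W, p • h = 0 := by
    intro h
    obtain ⟨v, rfl⟩ := Submodule.mkQ_surjective _ h
    rw [← map_nsmul, Submodule.mkQ_apply, Submodule.Quotient.mk_eq_zero]
    have := hp v v.2
    rw [Nat.cast_smul_eq_nsmul] at this
    simpa using this
  obtain ⟨z, hz1, hz2⟩ := @padic_basis p _ (K ⧸ Submodule.comap K.subtype W) _ _
    (AddCommGroup.zmodModule hpH) a hc hpH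
  choose x hx using fun i => Submodule.mkQ_surjective _ (z i)
  have hsum : ∀ β : Fin a → ℤ_[p], (Submodule.mkQ (Submodule.comap K.subtype W)) (∑ i, β i • x i)
      = ∑ i, β i • z i := by
    intro β
    simp only [map_sum, map_smul, hx]
  refine ⟨fun i => x i, fun i => (x i).2, ?_, ?_⟩
  · intro v hv
    obtain ⟨β, hβ⟩ := hz1 (Submodule.mkQ _ ⟨v, hv⟩)
    refine ⟨β, ?_⟩
    rw [← hsum, ← sub_eq_zero, ← map_sub, Submodule.mkQ_apply, Submodule.Quotient.mk_eq_zero] at hβ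
    simpa using hβ
  · intro β hβ
    apply hz2
    rw [← hsum, Submodule.mkQ_apply, Submodule.Quotient.mk_eq_zero]
    simpa using hβ

variable (T : Module.End ℤ_[p] A)

lemma mem_kerD {T : Module.End ℤ_[p] A} {v : A} : v ∈ LinearMap.ker (T - 1) ↔ T v = v := by
  simp [sub_eq_zero]

lemma p_kills0 (v : A) (hv : v ∈ LinearMap.ker (T - 1)) :
    (p : ℤ_[p]) • v ∈ LinearMap.range (nm p T) := by
  refine ⟨v, ?_⟩
  rw [nm_apply]
  simp [pow_fix T (mem_kerD.1 hv), Nat.cast_smul_eq_nsmul]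

lemma p_kills1 (v : A) (hv : v ∈ LinearMap.ker (nm p T)) :
    (p : ℤ_[p]) • v ∈ LinearMap.range (T - 1) := by
  have h : ∀ k, (T ^ k) v - v ∈ LinearMap.range (T - 1) := by
    intro k
    refine ⟨nm k T v, ?_⟩
    have := LinearMap.congr_fun (mul_geom_sum T k) v
    simpa [nm] using this
  have h2 : ∑ k ∈ range p, ((T ^ k) v - v) ∈ LinearMap.range (T - 1) :=
    Submodule.sum_mem _ fun k _ => h k
  rw [Finset.sum_sub_distrib, ← nm_apply, LinearMap.mem_ker.1 hv, zero_sub] at h2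
  have h3 := Submodule.neg_mem _ h2
  simpa [Nat.cast_smul_eq_nsmul] using h3

noncomputable def ww : Module.End ℤ_[p] A := ∑ k ∈ range p, k • T ^ k

lemma D_ww (hT : T ^ p = 1) (v : A) (hv : nm p T v = 0) : T (ww T v) - ww T v = (p : ℤ_[p]) • v := by
  have h : ∀ k : ℕ, T (k • (T ^ k) v) = (k + 1) • (T ^ (k + 1)) v - T ((T ^ k) v) := by
    intro k
    rw [pow_succ', Module.End.mul_apply, map_nsmul, add_smul, one_smul]
    abel
  have h2 : ww T v = ∑ k ∈ range p, k • (T ^ k) v := by simp [ww]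
  rw [h2, map_sum]
  simp_rw [h]
  rw [Finset.sum_sub_distrib, ← map_sum, ← nm_apply, hv, map_zero, sub_zero,
    ← Finset.sum_sub_distrib, Finset.sum_range_sub (fun k => k • (T ^ k) v)]
  simp [hT, Nat.cast_smul_eq_nsmul]

variable {a b : ℕ} (x : Fin a → A) (y : Fin b → A)

lemma f0_apply (m) : f0 p T x y m = (T m.1 - m.1 + ∑ i, m.2.1 i • x i + ∑ j, m.2.2 j • y j,
    -((p : ℤ_[p]) • m.2.1), 0) := by
  refine Prod.ext ?_ (Prod.ext ?_ ?_)
  · simp [f0, iA_apply, iX_apply, iY_apply, iP_apply, iQ_apply]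
  · simp [f0, iA_apply, iX_apply, iY_apply, iP_apply, iQ_apply, Nat.cast_smul_eq_nsmul]
  · simp [f0, iA_apply, iX_apply, iY_apply, iP_apply, iQ_apply]

lemma f1_apply (m) : f1 p T x y m = (nm p T m.1 + ∑ i, m.2.1 i • x i +
    ww T (∑ j, m.2.2 j • y j), 0, -((p : ℤ_[p]) • m.2.2)) := by
  refine Prod.ext ?_ (Prod.ext ?_ ?_)
  · simp [f1, iA_apply, iX_apply, iY_apply, iP_apply, iQ_apply, nm_apply, ww, Prod.fst_sum]
    simp_rw [Finset.smul_sum]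
    rw [Finset.sum_comm]
    refine Finset.sum_congr rfl fun j _ => Finset.sum_congr rfl fun k _ => ?_
    rw [smul_comm]
  · simp [f1, iA_apply, iX_apply, iY_apply, iP_apply, iQ_apply, Prod.snd_sum, Prod.fst_sum]
  · simp [f1, iA_apply, iX_apply, iY_apply, iP_apply, iQ_apply, Nat.cast_smul_eq_nsmul,
      Prod.snd_sum]

structure Dat (T : Module.End ℤ_[p] A) (x : Fin a → A) (y : Fin b → A) : Prop where
  hT : T ^ p = 1
  hx : ∀ i, T (x i) = x i
  hy : ∀ j, nm p T (y j) = 0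
  sx : ∀ v, T v = v → ∃ β : Fin a → ℤ_[p], ∃ u, v - ∑ i, β i • x i = nm p T u
  sy : ∀ v, nm p T v = 0 → ∃ β : Fin b → ℤ_[p], ∃ u, v - ∑ i, β i • y i = T u - u
  ix : ∀ β : Fin a → ℤ_[p], ∀ u, ∑ i, β i • x i = nm p T u → ∃ c : Fin a → ℤ_[p], β = (p : ℤ_[p]) • c
  iy : ∀ β : Fin b → ℤ_[p], ∀ u, ∑ i, β i • y i = T u - u → ∃ c : Fin b → ℤ_[p], β = (p : ℤ_[p]) • c

variable {T x y}

lemma Dat.Tx (h : Dat T x y) (β : Fin a → ℤ_[p]) : T (∑ i, β i • x i) = ∑ i, β i • x i := by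
  simp [h.hx]
lemma Dat.Ny (h : Dat T x y) (β : Fin b → ℤ_[p]) : nm p T (∑ i, β i • y i) = 0 := by
  simp [h.hy]
lemma nm_fix {v : A} (h : T v = v) : nm p T v = (p : ℤ_[p]) • v := by
  simp [nm_apply, pow_fix T h, Nat.cast_smul_eq_nsmul]

lemma p_ne : (p : ℤ_[p]) ≠ 0 := by exact_mod_cast (Fact.out : p.Prime).ne_zero

variable [Module.Free ℤ_[p] A]

lemma Dat.ker0 (h : Dat T x y) : LinearMap.ker (f0 p T x y) = LinearMap.range (f1 p T x y) := by
  apply le_antisymm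
  · rintro ⟨α, β, γ⟩ hm
    rw [LinearMap.mem_ker, f0_apply] at hm
    simp only [Prod.mk_eq_zero, neg_eq_zero, smul_eq_zero, p_ne, false_or] at hm
    obtain ⟨h1, rfl, -⟩ := hm
    simp only [Pi.zero_apply, zero_smul, Finset.sum_const_zero, add_zero] at h1
    obtain ⟨c, rfl⟩ := h.iy γ (-α) (by rw [map_neg, ← sub_eq_zero, ← h1]; abel)
    simp only [Pi.smul_apply, smul_assoc, ← Finset.smul_sum] at h1
    have h2 := D_ww T h.hT _ (h.Ny c)
    obtain ⟨β, u, hu⟩ := h.sx (α + ww T (∑ i, c i • y i)) (by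
      rw [← sub_eq_zero, map_add, ← h1, ← h2]; abel)
    refine ⟨(u, β, -c), ?_⟩
    rw [f1_apply]
    refine Prod.ext ?_ (Prod.ext rfl (by simp))
    simp only [Pi.neg_apply, neg_smul, Finset.sum_neg_distrib, map_neg, ← hu]
    abel
  · rintro _ ⟨⟨α, β, γ⟩, rfl⟩
    rw [LinearMap.mem_ker, f1_apply, f0_apply]
    refine Prod.ext ?_ (Prod.ext (by simp) rfl)
    simp only [Pi.zero_apply, zero_smul, Finset.sum_const_zero, add_zero, map_add, Pi.neg_apply,
      Pi.smul_apply, smul_assoc, neg_smul, Finset.sum_neg_distrib, ← Finset.smul_sum, Prod.fst_zero]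
    rw [← D_ww T h.hT _ (h.Ny γ), h.Tx, sub_eq_zero.1 (D_nm p h.hT α)]
    abel

lemma Dat.ker1 (h : Dat T x y) : LinearMap.ker (f1 p T x y) = LinearMap.range (f0 p T x y) := by
  apply le_antisymm
  · rintro ⟨α, β, γ⟩ hm
    rw [LinearMap.mem_ker, f1_apply] at hm
    simp only [Prod.mk_eq_zero, neg_eq_zero, smul_eq_zero, p_ne, false_or] at hm
    obtain ⟨h1, -, rfl⟩ := hm
    simp only [Pi.zero_apply, zero_smul, Finset.sum_const_zero, add_zero, map_zero] at h1
    obtain ⟨c, rfl⟩ := h.ix β (-α) (by rw [map_neg, ← sub_eq_zero, ← h1]; abel)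
    simp only [Pi.smul_apply, smul_assoc, ← Finset.smul_sum] at h1
    have h2 := nm_fix (h.Tx c)
    obtain ⟨γ, u, hu⟩ := h.sy (α + ∑ i, c i • x i) (by
      rw [map_add, ← h1, ← h2])
    refine ⟨(u, -c, γ), ?_⟩
    rw [f0_apply]
    refine Prod.ext ?_ (Prod.ext (by simp) rfl)
    simp only [Pi.neg_apply, neg_smul, Finset.sum_neg_distrib, ← hu]
    abel
  · rintro _ ⟨⟨α, β, γ⟩, rfl⟩
    rw [LinearMap.mem_ker, f0_apply, f1_apply]
    refine Prod.ext ?_ (Prod.ext rfl (by simp))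
    simp only [Pi.zero_apply, zero_smul, Finset.sum_const_zero, add_zero, map_add, Pi.neg_apply,
      Pi.smul_apply, smul_assoc, neg_smul, Finset.sum_neg_distrib, ← Finset.smul_sum, Prod.fst_zero,
      map_zero, nm_D p h.hT, h.Ny, nm_fix (h.Tx β)]
    abel

variable [Module.Finite ℤ_[p] A] {B : Type*} [AddCommGroup B] [Module ℤ_[p] B]
  [Module.Free ℤ_[p] B] [Module.Finite ℤ_[p] B] {S : Module.End ℤ_[p] B}

lemma Dat.kerE1 (h : Dat T x y) (hS : S ^ p = 1) (m) (hm : E1 p T S x y m = 0) :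
    ∃ n, m = E0 p T S x y n := by
  have key := tensor_acyclic S hS (e0 p T S x y) (e1 p T S x y) _ _ (rel0 p T S x y)
    (rel1 p T S x y) h.ker0 h.ker1 (by
      apply LinearMap.ext
      intro m
      apply EE.injective
      rw [Module.End.mul_apply, EE_e1, EE_e0, ← Module.End.mul_apply,
        E1E0 p T S x y h.hT hS h.hx h.hy]
      simp)
  obtain ⟨n, hn⟩ := key (show EE.symm m ∈ _ by
    rw [LinearMap.mem_ker]
    apply EE.injective
    rw [EE_e1]; simpa using hm)
  refine ⟨EE n, ?_⟩
  rw [← EE_e0, hn]; simp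

lemma Dat.kerE0 (h : Dat T x y) (hS : S ^ p = 1) (m) (hm : E0 p T S x y m = 0) :
    ∃ n, m = E1 p T S x y n := by
  have key := tensor_acyclic S hS (e1 p T S x y) (e0 p T S x y) _ _ (rel1 p T S x y)
    (rel0 p T S x y) h.ker1 h.ker0 (by
      apply LinearMap.ext
      intro m
      apply EE.injective
      rw [Module.End.mul_apply, EE_e0, EE_e1, ← Module.End.mul_apply,
        E0E1 p T S x y h.hT hS h.hx h.hy]
      simp)
  obtain ⟨n, hn⟩ := key (show EE.symm m ∈ _ by
    rw [LinearMap.mem_ker]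
    apply EE.injective
    rw [EE_e0]; simpa using hm)
  refine ⟨EE n, ?_⟩
  rw [← EE_e1, hn]; simp

end exactness

section counting
variable {R V W' : Type*} [CommRing R] [AddCommGroup V] [Module R V] [AddCommGroup W'] [Module R W']

lemma card_of_ker {X Y Z : Type*} [AddCommGroup X] [Module R X] [AddCommGroup Y] [Module R Y]
    [AddCommGroup Z] [Module R Z] (f : X →ₗ[R] Y) (g : X →ₗ[R] Z)
    (hf : Function.Surjective f) (hg : Function.Surjective g)
    (h : ∀ v, f v = 0 ↔ g v = 0) : Nat.card Y = Nat.card Z := by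
  have hk : LinearMap.ker f = LinearMap.ker g := by ext v; simpa using h v
  exact Nat.card_congr ((f.quotKerEquivOfSurjective hf).symm.toEquiv.trans
    ((Submodule.quotEquivOfEq _ _ hk).toEquiv.trans (g.quotKerEquivOfSurjective hg).toEquiv))

lemma count {a b : ℕ} (K1 W1 K2 W2 : Submodule R V) (K W : Submodule R W')
    (L1 : (Fin a → V) →ₗ[R] W') (L2 : (Fin b → V) →ₗ[R] W')
    (hmem : ∀ β γ, (∀ i, β i ∈ K1) → (∀ j, γ j ∈ K2) → L1 β + L2 γ ∈ K)
    (hsurj : ∀ α ∈ K, ∃ β γ, (∀ i, β i ∈ K1) ∧ (∀ j, γ j ∈ K2) ∧ α - (L1 β + L2 γ) ∈ W)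
    (hker : ∀ β γ, (∀ i, β i ∈ K1) → (∀ j, γ j ∈ K2) →
      (L1 β + L2 γ ∈ W ↔ (∀ i, β i ∈ W1) ∧ (∀ j, γ j ∈ W2))) :
    Nat.card (K ⧸ Submodule.comap K.subtype W) =
      Nat.card (K1 ⧸ Submodule.comap K1.subtype W1) ^ a *
      Nat.card (K2 ⧸ Submodule.comap K2.subtype W2) ^ b := by
  let F : ((Fin a → K1) × (Fin b → K2)) →ₗ[R] K :=
    LinearMap.codRestrict K (L1 ∘ₗ K1.subtype.compLeft (Fin a) ∘ₗ LinearMap.fst R _ _ +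
      L2 ∘ₗ K2.subtype.compLeft (Fin b) ∘ₗ LinearMap.snd R _ _) (by
        intro m
        exact hmem (fun i => m.1 i) (fun j => m.2 j) (fun i => (m.1 i).2) (fun j => (m.2 j).2))
  have hF : ∀ m, (F m : W') = L1 (fun i => m.1 i) + L2 (fun j => m.2 j) := fun m => rfl
  let G : ((Fin a → K1) × (Fin b → K2)) →ₗ[R]
      (Fin a → K1 ⧸ Submodule.comap K1.subtype W1) × (Fin b → K2 ⧸ Submodule.comap K2.subtype W2) :=
    LinearMap.prodMap ((Submodule.mkQ _).compLeft (Fin a)) ((Submodule.mkQ _).compLeft (Fin b))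
  have hG : ∀ m, G m = (fun i => Submodule.mkQ _ (m.1 i), fun j => Submodule.mkQ _ (m.2 j)) :=
    fun m => rfl
  have := card_of_ker ((Submodule.mkQ (Submodule.comap K.subtype W)) ∘ₗ F) G ?_ ?_ ?_
  · rw [this]
    simp [Nat.card_prod, Nat.card_fun]
  · intro q
    obtain ⟨α, rfl⟩ := Submodule.mkQ_surjective _ q
    obtain ⟨β, γ, h1, h2, h3⟩ := hsurj α α.2
    refine ⟨(fun i => ⟨β i, h1 i⟩, fun j => ⟨γ j, h2 j⟩), ?_⟩
    rw [LinearMap.comp_apply, ← sub_eq_zero, ← map_sub, Submodule.mkQ_apply,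
      Submodule.Quotient.mk_eq_zero, Submodule.mem_comap, ← Submodule.neg_mem_iff]
    convert h3 using 1
    simp [hF]
  · rintro ⟨u, v⟩
    choose u' hu using fun i => Submodule.mkQ_surjective _ (u i)
    choose v' hv using fun i => Submodule.mkQ_surjective _ (v i)
    refine ⟨(u', v'), ?_⟩
    rw [hG]
    exact Prod.ext (funext hu) (funext hv)
  · rintro ⟨u, v⟩
    have := hker (fun i => u i) (fun j => v j) (fun i => (u i).2) (fun i => (v i).2)
    rw [LinearMap.comp_apply, Submodule.mkQ_apply, Submodule.Quotient.mk_eq_zero,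
      Submodule.mem_comap, Submodule.subtype_apply, hF, hG, Prod.mk_eq_zero, this]
    simp [funext_iff]
end counting

section final
variable {p : ℕ} [Fact p.Prime] {A : Type*} [AddCommGroup A] [Module ℤ_[p] A]

abbrev H0 (p : ℕ) [Fact p.Prime] {A : Type*} [AddCommGroup A] [Module ℤ_[p] A]
    (T : Module.End ℤ_[p] A) : Type _ :=
  LinearMap.ker (T - 1) ⧸ Submodule.comap (LinearMap.ker (T - 1)).subtype (LinearMap.range (nm p T))

abbrev H1 (p : ℕ) [Fact p.Prime] {A : Type*} [AddCommGroup A] [Module ℤ_[p] A]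
    (T : Module.End ℤ_[p] A) : Type _ :=
  LinearMap.ker (nm p T) ⧸ Submodule.comap (LinearMap.ker (nm p T)).subtype (LinearMap.range (T - 1))

lemma exists_dat {T : Module.End ℤ_[p] A} (hT : T ^ p = 1) {a b : ℕ}
    (h0 : Nat.card (H0 p T) = p ^ a) (h1 : Nat.card (H1 p T) = p ^ b) :
    ∃ (x : Fin a → A) (y : Fin b → A), Dat T x y := by
  obtain ⟨x, hx, sx, ix⟩ := exists_basis _ _ a h0 (p_kills0 T)
  obtain ⟨y, hy, sy, iy⟩ := exists_basis _ _ b h1 (p_kills1 T)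
  refine ⟨x, y, hT, fun i => mem_kerD.1 (hx i), fun j => hy j, ?_, ?_, ?_, ?_⟩
  · intro v hv
    obtain ⟨β, u, hu⟩ := sx v (mem_kerD.2 hv)
    exact ⟨β, u, hu.symm⟩
  · intro v hv
    obtain ⟨β, u, hu⟩ := sy v hv
    exact ⟨β, u, hu.symm⟩
  · intro β u hu
    choose c hc using ix β ⟨u, hu.symm⟩
    exact ⟨c, funext hc⟩
  · intro β u hu
    choose c hc using iy β ⟨u, hu.symm⟩
    exact ⟨c, funext hc⟩

variable [Module.Free ℤ_[p] A] [Module.Finite ℤ_[p] A] {B : Type*} [AddCommGroup B]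
  [Module ℤ_[p] B] [Module.Free ℤ_[p] B] [Module.Finite ℤ_[p] B] {S : Module.End ℤ_[p] B}
  {T : Module.End ℤ_[p] A} {a b : ℕ} {x : Fin a → A} {y : Fin b → A}

lemma Dat.card0 (h : Dat T x y) (hS : S ^ p = 1) :
    Nat.card (H0 p (TensorProduct.map T S)) = Nat.card (H0 p S) ^ a * Nat.card (H1 p S) ^ b := by
  apply count _ _ _ _ _ _ (lin x) (lcup p T S y)
  · intro β γ hβ hγ
    rw [mem_kerD, ← sub_eq_zero, map_add, add_sub_add_comm, D_lin T S x h.hx,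
      D_lcup p T S y h.hT h.hy]
    have e1 : (fun i => S (β i) - β i) = 0 := funext fun i => sub_eq_zero.2 (mem_kerD.1 (hβ i))
    have e2 : (fun i => nm p S (γ i)) = 0 := funext fun i => hγ i
    rw [e1, e2]; simp
  · intro α hα
    obtain ⟨⟨α', β, γ⟩, hn⟩ := h.kerE0 hS (α, 0, 0) (by
      rw [E0_apply]; simp [sub_eq_zero, mem_kerD.1 hα])
    rw [E1_apply, Prod.mk.injEq, Prod.mk.injEq] at hn
    obtain ⟨h1, h2, h3⟩ := hn
    refine ⟨β, γ, fun i => ?_, fun j => ?_, α', ?_⟩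
    · have := congrFun h2 i
      exact neg_eq_zero.1 this.symm
    · have := congrFun h3 j
      exact neg_eq_zero.1 this.symm
    · rw [h1]; abel
  · intro β γ hβ hγ
    constructor
    · rintro ⟨α', hα'⟩
      obtain ⟨⟨u, v, w⟩, hn⟩ := h.kerE1 hS (-α', β, γ) (by
        rw [E1_apply]
        refine Prod.ext ?_ (Prod.ext (funext fun i => ?_) (funext fun j => ?_))
        · simp [hα', add_assoc]
        · exact neg_eq_zero.2 (hβ i)
        · exact neg_eq_zero.2 (hγ j))
      rw [E0_apply, Prod.mk.injEq, Prod.mk.injEq] at hn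
      obtain ⟨-, h2, h3⟩ := hn
      refine ⟨fun i => ⟨- v i, ?_⟩, fun j => ⟨- w j, ?_⟩⟩
      · rw [h2, map_neg]; rfl
      · rw [h3, map_neg]; rfl
    · rintro ⟨h1, h2⟩
      choose v hv using h1
      choose w hw using h2
      refine ⟨lin x v + lin y w, ?_⟩
      rw [map_add, nm_lin p T S x h.hx, nm_lin_y p T S y h.hy]
      simp only [hv]
      congr 2
      funext j
      rw [← hw j]; rfl

lemma Dat.card1 (h : Dat T x y) (hS : S ^ p = 1) :
    Nat.card (H1 p (TensorProduct.map T S)) = Nat.card (H1 p S) ^ a * Nat.card (H0 p S) ^ b := by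
  apply count _ _ _ _ _ _ (lin x) (lin y)
  · intro β γ hβ hγ
    rw [LinearMap.mem_ker, map_add, nm_lin p T S x h.hx, nm_lin_y p T S y h.hy]
    have e1 : (fun i => S (γ i) - γ i) = 0 := funext fun i => sub_eq_zero.2 (mem_kerD.1 (hγ i))
    have e2 : (fun i => nm p S (β i)) = 0 := funext fun i => hβ i
    rw [e1, e2]; simp
  · intro α hα
    obtain ⟨⟨α', β, γ⟩, hn⟩ := h.kerE1 hS (α, 0, 0) (by
      rw [E1_apply]; simpa using hα)
    rw [E0_apply, Prod.mk.injEq, Prod.mk.injEq] at hn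
    obtain ⟨h1, h2, h3⟩ := hn
    refine ⟨β, γ, fun i => ?_, fun j => ?_, α', ?_⟩
    · have := congrFun h2 i
      exact neg_eq_zero.1 this.symm
    · have := congrFun h3 j
      exact neg_eq_zero.1 this.symm
    · rw [h1, LinearMap.sub_apply, Module.End.one_apply]; abel
  · intro β γ hβ hγ
    constructor
    · rintro ⟨α', hα'⟩
      obtain ⟨⟨u, v, w⟩, hn⟩ := h.kerE0 hS (-α', β, γ) (by
        rw [E0_apply]
        refine Prod.ext ?_ (Prod.ext (funext fun i => ?_) (funext fun j => ?_))
        · rw [LinearMap.sub_apply, Module.End.one_apply] at hα'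
          simp only [map_neg, add_assoc, ← hα', Prod.fst_zero]
          abel
        · exact neg_eq_zero.2 (hβ i)
        · exact neg_eq_zero.2 (hγ j))
      rw [E1_apply, Prod.mk.injEq, Prod.mk.injEq] at hn
      obtain ⟨-, h2, h3⟩ := hn
      refine ⟨fun i => ⟨- v i, ?_⟩, fun j => ⟨- w j, ?_⟩⟩
      · rw [h2, map_neg]; rfl
      · rw [h3, map_neg]; rfl
    · rintro ⟨h1, h2⟩
      choose v hv using h1
      choose w hw using h2
      refine ⟨lin x v + lcup p T S y w, ?_⟩
      rw [LinearMap.sub_apply, Module.End.one_apply, map_add, add_sub_add_comm,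
        D_lin T S x h.hx, D_lcup p T S y h.hT h.hy]
      simp only [hw]
      congr 2
      funext j
      rw [← hv j]; rfl

end final

section rep
variable {p : ℕ} [Fact p.Prime] {V : Type*} [AddCommGroup V] [Module ℤ_[p] V]
  (ρ : Representation ℤ_[p] (Gp p) V)

lemma gen_pow (k : ℕ) : gen p ^ k = Multiplicative.ofAdd (k : ZMod p) := by
  rw [gen, ← ofAdd_nsmul, nsmul_one]

lemma rho_pow : (ρ (gen p)) ^ p = 1 := by
  rw [← map_pow, gen_pow]
  simp

lemma normMap_eq : normMap p ρ = nm p (ρ (gen p)) := by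
  rw [normMap, nm]
  symm
  refine Finset.sum_bij (fun k _ => gen p ^ k) (fun _ _ => Finset.mem_univ _) ?_ ?_ ?_
  · intro i hi j hj h
    rw [gen_pow, gen_pow] at h
    have h' : ((i : ℕ) : ZMod p) = j := Multiplicative.ofAdd.injective h
    rw [ZMod.natCast_eq_natCast_iff'] at h'
    rwa [Nat.mod_eq_of_lt (Finset.mem_range.1 hi), Nat.mod_eq_of_lt (Finset.mem_range.1 hj)] at h'
  · intro g _
    refine ⟨(Multiplicative.toAdd g).val, Finset.mem_range.2 (ZMod.val_lt _), ?_⟩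
    rw [gen_pow, ZMod.natCast_zmod_val]; rfl
  · intro k _
    rw [map_pow]

lemma inv_eq : ρ.invariants = LinearMap.ker (ρ (gen p) - 1) := by
  ext v
  rw [Representation.mem_invariants, mem_kerD]
  constructor
  · intro h; exact h _
  · intro h g
    have : g = gen p ^ (Multiplicative.toAdd g).val := by
      rw [gen_pow, ZMod.natCast_zmod_val]; rfl
    rw [this, map_pow]
    exact pow_fix _ h _

lemma card_H0 : Nat.card (TateH0 p ρ) = Nat.card (H0 p (ρ (gen p))) := by
  unfold TateH0
  rw [normMap_eq]
  have : ∀ K K' W : Submodule ℤ_[p] V, K = K' → Nat.card (K ⧸ Submodule.comap K.subtype W) =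
      Nat.card (K' ⧸ Submodule.comap K'.subtype W) := by
    rintro K K' W rfl; rfl
  exact this _ _ _ (inv_eq ρ)

lemma card_H1 : Nat.card (TateH1 p ρ) = Nat.card (H1 p (ρ (gen p))) := by
  unfold TateH1
  rw [normMap_eq]
  rfl
end rep

end TK

/-- **Statement 2.** Künneth formula for the Tate cohomology of a tensor product of
`ℤ_p[G]`-modules that are finitely generated and free over `ℤ_p`.  Dimensions over
`F_p` are expressed via cardinalities: a finite-dimensional `F_p`-vector space of
dimension `d` has cardinality `p ^ d`. -/
theorem tate_kunneth (p : ℕ) [Fact p.Prime]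
    (A B : Type*) [AddCommGroup A] [Module ℤ_[p] A] [AddCommGroup B] [Module ℤ_[p] B]
    [Module.Free ℤ_[p] A] [Module.Finite ℤ_[p] A]
    [Module.Free ℤ_[p] B] [Module.Finite ℤ_[p] B]
    (ρ : Representation ℤ_[p] (Gp p) A) (σ : Representation ℤ_[p] (Gp p) B)
    (a b c d : ℕ)
    (h0A : Nat.card (TateH0 p ρ) = p ^ a) (h1A : Nat.card (TateH1 p ρ) = p ^ b)
    (h0B : Nat.card (TateH0 p σ) = p ^ c) (h1B : Nat.card (TateH1 p σ) = p ^ d) :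
    Nat.card (TateH0 p (ρ.tprod σ)) = p ^ (a * c + b * d) ∧
    Nat.card (TateH1 p (ρ.tprod σ)) = p ^ (a * d + b * c) := by
  have hρ := TK.rho_pow ρ
  have hσ := TK.rho_pow σ
  rw [TK.card_H0] at h0A h0B ⊢
  rw [TK.card_H1] at h1A h1B ⊢
  obtain ⟨x, y, h⟩ := TK.exists_dat hρ h0A h1A
  rw [Representation.tprod_apply, h.card0 hσ, h.card1 hσ, h0B, h1B, ← pow_mul, ← pow_mul,
    ← pow_mul, ← pow_mul, ← pow_add, ← pow_add]
  constructor <;> congr 1 <;> ring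
end

section
/- Let p be a prime, let A_0, A_1, …, A_n be finitely generated free ℤ_p-modules (and set A_{−1} = A_{n+1} = 0), and suppose given ℤ_p-linear maps d : A_i → A_{i+1} and d* : A_{i+1} → A_i for all i such that d∘d = 0, d*∘d* = 0, and d∘d* + d*∘d = k·id on each A_i, where k is an integer coprime to p. Then each A_i decomposes as the internal direct sum A_i = (d∘d*)(A_i) ⊕ (d*∘d)(A_i), and d restricts to an isomorphism from (d*∘d)(A_i) onto (d∘d*)(A_{i+1}). -/
/-- **Statement 12.** Let `A_i` (for `i : ℤ`) be finitely generated free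
`ℤ_p`-modules which vanish outside `0 ≤ i ≤ n`, equipped with maps `d : A_i → A_{i+1}`
and `d* : A_{i+1} → A_i` satisfying `d² = 0`, `d*² = 0` and `d∘d* + d*∘d = k·id` with
`k` an integer coprime to `p`.  Then each `A_i` is the internal direct sum
`(d∘d*)(A_i) ⊕ (d*∘d)(A_i)`, and `d` restricts to an isomorphism from `(d*∘d)(A_i)`
onto `(d∘d*)(A_{i+1})`. -/
theorem hodge_decomposition (p : ℕ) [Fact p.Prime] (n : ℤ)
    (A : ℤ → Type*) [∀ i, AddCommGroup (A i)] [∀ i, Module ℤ_[p] (A i)]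
    (hfree : ∀ i, Module.Free ℤ_[p] (A i)) (hfin : ∀ i, Module.Finite ℤ_[p] (A i))
    (hvanish : ∀ i : ℤ, (i < 0 ∨ n < i) → Subsingleton (A i))
    (d : ∀ i, A i →ₗ[ℤ_[p]] A (i + 1)) (e : ∀ i, A (i + 1) →ₗ[ℤ_[p]] A i)
    (k : ℤ) (hk : ¬ (p : ℤ) ∣ k)
    (hd : ∀ i, (d (i + 1)).comp (d i) = 0)
    (he : ∀ i, (e i).comp (e (i + 1)) = 0)
    (hlap : ∀ i, (d i).comp (e i) + (e (i + 1)).comp (d (i + 1))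
      = (k : ℤ_[p]) • LinearMap.id) :
    ∀ i : ℤ,
      IsCompl (LinearMap.range ((d i).comp (e i)))
        (LinearMap.range ((e (i + 1)).comp (d (i + 1)))) ∧
      Set.InjOn (d (i + 1))
        (LinearMap.range ((e (i + 1)).comp (d (i + 1)))) ∧
      Submodule.map (d (i + 1)) (LinearMap.range ((e (i + 1)).comp (d (i + 1))))
        = LinearMap.range ((d (i + 1)).comp (e (i + 1))) := by
  intro i
  have hu : IsUnit (k : ℤ_[p]) := by
    rw [PadicInt.isUnit_iff]
    by_contra h
    exact hk ((PadicInt.norm_int_lt_one_iff_dvd k).1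
      (lt_of_le_of_ne (PadicInt.norm_le_one _) h))
  obtain ⟨u, hu⟩ := hu.exists_left_inv
  have hd' : ∀ i x, d (i + 1) (d i x) = 0 := fun i x => LinearMap.congr_fun (hd i) x
  have he' : ∀ i x, e i (e (i + 1) x) = 0 := fun i x => LinearMap.congr_fun (he i) x
  have hl : ∀ i x, d i (e i x) + e (i + 1) (d (i + 1) x) = (k : ℤ_[p]) • x :=
    fun i x => LinearMap.congr_fun (hlap i) x
  have huk : ∀ i (x : A i), u • (k : ℤ_[p]) • x = x := fun i x => by
    rw [smul_smul, hu, one_smul]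
  have key : ∀ x : A (i + 1), e i x = 0 → d (i + 1) x = 0 → x = 0 := by
    intro x h1 h2
    have h := hl i x
    rw [h1, h2, map_zero, map_zero, add_zero] at h
    rw [← huk _ x, ← h, smul_zero]
  refine ⟨⟨?_, ?_⟩, ?_, ?_⟩
  · rw [Submodule.disjoint_def]
    rintro x ⟨a, ha⟩ ⟨b, hb⟩
    apply key
    · rw [← hb]
      exact he' _ _
    · rw [← ha]
      exact hd' _ _
  · rw [codisjoint_iff, eq_top_iff]
    intro x _
    rw [Submodule.mem_sup]
    refine ⟨_, ⟨u • x, rfl⟩, _, ⟨u • x, rfl⟩, ?_⟩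
    simp only [LinearMap.comp_apply]
    rw [hl, smul_comm, huk]
  · rintro x ⟨a, rfl⟩ y ⟨b, rfl⟩ hxy
    rw [← sub_eq_zero]
    apply key
    · simp only [LinearMap.comp_apply, map_sub, he', sub_zero]
    · rw [map_sub, hxy, sub_self]
  · apply le_antisymm
    · rintro _ ⟨_, ⟨a, rfl⟩, rfl⟩
      exact ⟨d (i + 1) a, rfl⟩
    · rintro _ ⟨b, rfl⟩
      refine ⟨_, ⟨e (i + 1) (u • b), rfl⟩, ?_⟩
      have h := hl (i + 1) (u • b)
      simp only [LinearMap.comp_apply]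
      rw [eq_sub_of_add_eq h, map_sub, he', sub_zero, smul_comm, huk]
end

section
/- Let E_8 be the E_8 root lattice, i.e., the even unimodular positive definite lattice of rank 8 (realized for instance as ℤ^8 with Gram matrix the Cartan matrix of type E_8). Then the exterior square Λ²(E_8), equipped with the bilinear form determined by (a_1∧a_2, b_1∧b_2) = (a_1,b_1)(a_2,b_2) − (a_1,b_2)(a_2,b_1), is a positive definite self dual (unimodular) lattice of rank 28 which contains no roots, i.e., no vector λ with (λ, λ) = 2. In particular there exists a 28-dimensional self dual positive definite lattice with no roots. -/
/-- The wedge `a₁ ∧ ⋯ ∧ aₙ`, as an element of the `n`-th exterior power. -/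
noncomputable def wedge (R : Type*) [CommRing R] {M : Type*} [AddCommGroup M]
    [Module R M] (n : ℕ) (a : Fin n → M) : ⋀[R]^n M :=
  ⟨ExteriorAlgebra.ιMulti R n a,
    ExteriorAlgebra.ιMulti_range R n (Set.mem_range_self a)⟩

/-- The `E₈` root lattice: `ℤ^8` with the bilinear form whose Gram matrix is the
Cartan matrix of type `E₈`. -/
noncomputable def E8form : (Fin 8 → ℤ) →ₗ[ℤ] (Fin 8 → ℤ) →ₗ[ℤ] ℤ :=
  Matrix.toLinearMap₂' ℤ CartanMatrix.E₈

open Finset in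
lemma e8_split (f : Fin 8 → Fin 8 → ℤ) (hd : ∀ i, f i i = 0) :
    ∑ i, ∑ j, f i j = ∑ p ∈ (univ : Finset (Fin 8 × Fin 8)).filter (fun p => p.1 < p.2),
      (f p.1 p.2 + f p.2 p.1) := by
  rw [Finset.sum_filter, ← Finset.univ_product_univ, Finset.sum_product]
  have h1 : ∀ i j : Fin 8, f i j = (if i < j then f i j else 0) + (if j < i then f i j else 0) := by
    intro i j
    rcases lt_trichotomy i j with h | h | h
    · simp [h, h.le]
    · subst h; simp [hd]
    · simp [h, h.le]
  have h2 : ∑ i, ∑ j, f i j = ∑ i, ∑ j, (if i < j then f i j else 0)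
      + ∑ i, ∑ j, (if j < i then f i j else 0) := by
    rw [← Finset.sum_add_distrib]
    refine Finset.sum_congr rfl fun i _ => ?_
    rw [← Finset.sum_add_distrib]
    exact Finset.sum_congr rfl fun j _ => h1 i j
  rw [h2, Finset.sum_comm (f := fun i j => if j < i then f i j else 0), ← Finset.sum_add_distrib]
  refine Finset.sum_congr rfl fun i _ => ?_
  rw [← Finset.sum_add_distrib]
  refine Finset.sum_congr rfl fun j _ => ?_
  split_ifs <;> simp

/-- Pairing with an orthogonal frame of roots. -/
def e8S : Matrix (Fin 8) (Fin 8) ℤ :=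
  !![0, 0, 0, 0, 0, -1, 2, -1;
     0, 2, 0, -1, 0, 0, 0, 0;
     2, 0, -1, 0, 0, 0, 0, 0;
     0, 0, 0, -1, 2, -1, 0, 0;
     0, 0, 1, 0, 0, -1, 0, 0;
     0, 0, 1, -1, 0, 1, 0, -1;
     0, 0, -1, 1, 0, 0, 0, -1;
     0, 0, 0, 0, 0, 0, 0, 1]

/-- Rows: an orthogonal frame of roots. -/
def e8Rt : Matrix (Fin 8) (Fin 8) ℤ :=
  !![0, 0, 0, 0, 0, 0, 1, 0;
     0, 1, 0, 0, 0, 0, 0, 0;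
     1, 0, 0, 0, 0, 0, 0, 0;
     0, 0, 0, 0, 1, 0, 0, 0;
     1, 1, 2, 2, 1, 0, 0, 0;
     1, 1, 2, 2, 2, 2, 1, 0;
     1, 2, 2, 4, 3, 2, 1, 0;
     2, 3, 4, 6, 5, 4, 3, 2]

def e8P : Matrix (Fin 8) (Fin 4) (ZMod 2) :=
  !![0, 0, 1, 1; 0, 1, 0, 0; 1, 0, 0, 0; 0, 1, 1, 0; 1, 0, 1, 0; 1, 1, 1, 1; 1, 1, 0, 1; 0, 0, 0, 1]

def e8Q : Matrix (Fin 4) (Fin 8) (ZMod 2) :=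
  !![0, 0, 1, 0, 0, 0, 0, 0; 0, 0, 0, 1, 0, 0, 0, 0; 0, 0, 0, 0, 0, 1, 0, 0; 0, 0, 0, 0, 0, 0, 0, 1]

lemma e8_StS : e8S.transpose * e8S = (2 : ℤ) • CartanMatrix.E₈ := by decide +kernel

lemma e8_RS : e8Rt.transpose * e8S = (2 : ℤ) • (1 : Matrix (Fin 8) (Fin 8) ℤ) := by decide +kernel

lemma e8_PQ : e8S.map (Int.castRingHom (ZMod 2)) = e8P * e8Q := by decide +kernel

def e8Y (a b c d e f : ZMod 2) : Matrix (Fin 4) (Fin 4) (ZMod 2) :=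
  !![0, a, b, c; a, 0, d, e; b, d, 0, f; c, e, f, 0]

lemma e8_code : ∀ a b c d e f : ZMod 2,
    (e8P * e8Y a b c d e f * e8P.transpose = 0) ∨
    17 ≤ ((Finset.univ : Finset (Fin 8 × Fin 8)).filter
      (fun p => (e8P * e8Y a b c d e f * e8P.transpose) p.1 p.2 ≠ 0)).card := by
  decide +kernel

lemma e8_minors : ∀ p q : Fin 8 × Fin 8, p.1 < p.2 → q.1 < q.2 → p ≠ q →
    ∃ k l : Fin 8, (e8Rt p.1 k * e8Rt p.2 l - e8Rt p.2 k * e8Rt p.1 l +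
      (e8Rt q.1 k * e8Rt q.2 l - e8Rt q.2 k * e8Rt q.1 l)) % 2 = 1 := by
  decide +kernel

lemma e8_Y (Z : Matrix (Fin 8) (Fin 8) (ZMod 2)) (hd : ∀ i, Z i i = 0)
    (hZ : ∀ i j, Z j i = Z i j) : e8Q * Z * e8Q.transpose =
      e8Y (Z 2 3) (Z 2 5) (Z 2 7) (Z 3 5) (Z 3 7) (Z 5 7) := by
  ext i j
  fin_cases i <;> fin_cases j <;>
    simp [e8Q, e8Y, Matrix.mul_apply, Matrix.vecMul, dotProduct, Fin.sum_univ_eight, hd,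
      hZ 2 3, hZ 2 5, hZ 2 7, hZ 3 5, hZ 3 7, hZ 5 7]

open Finset in
lemma e8_no_two (X B : Matrix (Fin 8) (Fin 8) ℤ) (hX : ∀ i j, X j i = - X i j)
    (hB : B = e8S * X * e8S.transpose) (hs : ∑ i, ∑ j, B i j ^ 2 = 16) : False := by
  have hXt : X.transpose = -X := by ext i j; simpa using hX i j
  have hBt : B.transpose = -B := by
    rw [hB]; simp [Matrix.transpose_mul, hXt, Matrix.mul_assoc]
  have hBs : ∀ i j, B j i = - B i j := fun i j => by
    have := congrFun (congrFun hBt i) j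
    simpa using this
  -- step 1: B even
  have hev : ∀ i j, (2 : ℤ) ∣ B i j := by
    set φ := Int.castRingHom (ZMod 2)
    have hneg : ∀ z : ZMod 2, -z = z := by decide
    have hXd : ∀ i, X i i = 0 := fun i => by have := hX i i; omega
    have hX2 : ∀ i j, φ (X j i) = φ (X i j) := fun i j => by rw [hX i j, map_neg, hneg]
    have hY : e8Q * X.map φ * e8Q.transpose =
        e8Y (φ (X 2 3)) (φ (X 2 5)) (φ (X 2 7)) (φ (X 3 5)) (φ (X 3 7)) (φ (X 5 7)) := by
      exact e8_Y (X.map φ) (fun i => by simp [hXd]) (fun i j => hX2 i j)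
    have hBm : B.map φ = e8P * e8Y (φ (X 2 3)) (φ (X 2 5)) (φ (X 2 7)) (φ (X 3 5)) (φ (X 3 7)) (φ (X 5 7)) * e8P.transpose := by
      rw [← hY, hB, Matrix.map_mul, Matrix.map_mul, Matrix.transpose_map, e8_PQ,
        Matrix.transpose_mul]
      simp only [Matrix.mul_assoc]
    have hz : ∀ z : ℤ, φ z = 0 ↔ (2 : ℤ) ∣ z := fun z => ZMod.intCast_zmod_eq_zero_iff_dvd z 2
    rcases e8_code (φ (X 2 3)) (φ (X 2 5)) (φ (X 2 7)) (φ (X 3 5)) (φ (X 3 7)) (φ (X 5 7)) with h | h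
    · intro i j
      rw [← hBm] at h
      exact (hz _).1 (congrFun (congrFun h i) j)
    · exfalso
      rw [← hBm] at h
      have h3 : ∑ p : Fin 8 × Fin 8, B p.1 p.2 ^ 2 = 16 := by
        rw [← hs, ← Finset.univ_product_univ, Finset.sum_product]
      have h4 : (((univ : Finset (Fin 8 × Fin 8)).filter
          (fun p => (B.map φ) p.1 p.2 ≠ 0)).card : ℤ) ≤ ∑ p : Fin 8 × Fin 8, B p.1 p.2 ^ 2 := by
        rw [Finset.card_filter]
        push_cast
        refine Finset.sum_le_sum fun p _ => ?_
        split_ifs with hp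
        · have : B p.1 p.2 ≠ 0 := fun h0 => hp (by simp [h0])
          have := sq_pos_of_ne_zero this
          omega
        · positivity
      rw [h3] at h4
      have h5 : ((univ : Finset (Fin 8 × Fin 8)).filter
          (fun p => (B.map φ) p.1 p.2 ≠ 0)).card ≤ 16 := by exact_mod_cast h4
      omega
  choose b hb using hev
  have hbs : ∀ i j, b j i = - b i j := fun i j => by
    have := hBs i j; rw [hb, hb] at this; linarith
  have hbd : ∀ i, b i i = 0 := fun i => by have := hbs i i; omega
  set U := (univ : Finset (Fin 8 × Fin 8)).filter (fun p => p.1 < p.2) with hU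
  have hsum : ∑ p ∈ U, b p.1 p.2 ^ 2 = 2 := by
    have h1 := e8_split (fun i j => B i j ^ 2) (fun i => by simp [hb, hbd])
    rw [hs] at h1
    have h2 : ∀ p ∈ U, B p.1 p.2 ^ 2 + B p.2 p.1 ^ 2 = 8 * b p.1 p.2 ^ 2 := fun p _ => by
      rw [hb, hb, hbs p.1 p.2]; ring
    rw [Finset.sum_congr rfl h2, ← Finset.mul_sum] at h1
    linarith
  have hle : ∀ p ∈ U, b p.1 p.2 ^ 2 ≤ 2 := fun p hp => by
    rw [← hsum]
    exact Finset.single_le_sum (f := fun p : Fin 8 × Fin 8 => b p.1 p.2 ^ 2) (fun _ _ => sq_nonneg _) hp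
  have h01 : ∀ p ∈ U, b p.1 p.2 ^ 2 = if b p.1 p.2 ≠ 0 then 1 else 0 := fun p hp => by
    have h := hle p hp
    have h1 : b p.1 p.2 ≤ 1 := by nlinarith
    have h2 : -1 ≤ b p.1 p.2 := by nlinarith
    generalize b p.1 p.2 = z at *
    interval_cases z <;> simp
  rw [Finset.sum_congr rfl h01, ← Finset.sum_filter, Finset.sum_const] at hsum
  have hcard : (U.filter (fun p => b p.1 p.2 ≠ 0)).card = 2 := by
    simp at hsum
    exact_mod_cast hsum
  obtain ⟨p, q, hpq, hset⟩ := Finset.card_eq_two.1 hcard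
  have hp : p ∈ U.filter (fun p => b p.1 p.2 ≠ 0) := by rw [hset]; simp
  have hq : q ∈ U.filter (fun p => b p.1 p.2 ≠ 0) := by rw [hset]; simp
  rw [Finset.mem_filter] at hp hq
  have odd : ∀ p, p ∈ U ∧ b p.1 p.2 ≠ 0 → b p.1 p.2 = 1 ∨ b p.1 p.2 = -1 := fun p hp => by
    have := h01 p hp.1
    rw [if_pos hp.2] at this
    simpa using this
  obtain ⟨k, l, hkl⟩ := e8_minors p q (by simpa [hU] using hp.1) (by simpa [hU] using hq.1) hpq
  have hR : e8Rt.transpose * B * e8Rt = (4 : ℤ) • X := by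
    have e2 : e8S.transpose * e8Rt = (2 : ℤ) • (1 : Matrix (Fin 8) (Fin 8) ℤ) := by
      have := congrArg Matrix.transpose e8_RS
      simpa [Matrix.transpose_mul] using this
    calc e8Rt.transpose * B * e8Rt = (e8Rt.transpose * e8S) * X * (e8S.transpose * e8Rt) := by
          rw [hB]; simp only [Matrix.mul_assoc]
      _ = _ := by rw [e8_RS, e2, Matrix.smul_mul, Matrix.one_mul, Matrix.mul_smul, Matrix.mul_one, smul_smul]; norm_num
  have hkl2 : ∑ i, ∑ j, e8Rt i k * e8Rt j l * b i j = 2 * X k l := by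
    have := congrFun (congrFun hR k) l
    simp only [Matrix.mul_apply, Matrix.transpose_apply, Matrix.smul_apply, smul_eq_mul,
      Finset.sum_mul] at this
    rw [Finset.sum_comm] at this
    have h2 : 2 * ∑ i, ∑ j, e8Rt i k * e8Rt j l * b i j = 4 * X k l := by
      rw [← this, Finset.mul_sum]
      refine Finset.sum_congr rfl fun i _ => ?_
      rw [Finset.mul_sum]
      refine Finset.sum_congr rfl fun j _ => ?_
      rw [hb]; ring
    linarith
  rw [e8_split _ (fun i => by simp [hbd])] at hkl2
  have h5 : ∑ p ∈ U, (e8Rt p.1 k * e8Rt p.2 l * b p.1 p.2 + e8Rt p.2 k * e8Rt p.1 l * b p.2 p.1)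
      = ∑ p ∈ U.filter (fun p => b p.1 p.2 ≠ 0),
        (e8Rt p.1 k * e8Rt p.2 l - e8Rt p.2 k * e8Rt p.1 l) * b p.1 p.2 := by
    rw [Finset.sum_filter (s := U)]
    refine Finset.sum_congr rfl fun r _ => ?_
    rw [hbs r.1 r.2]
    split_ifs with h0
    · ring
    · push Not at h0
      rw [h0]; ring
  rw [h5, hset, Finset.sum_pair hpq] at hkl2
  generalize e8Rt p.1 k * e8Rt p.2 l - e8Rt p.2 k * e8Rt p.1 l = m at *
  generalize e8Rt q.1 k * e8Rt q.2 l - e8Rt q.2 k * e8Rt q.1 l = n at *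
  rcases odd p hp with h | h <;> rcases odd q hq with h' | h' <;> rw [h, h'] at hkl2 <;> omega

/-- The functional `f ∧ g` on the exterior square. -/
noncomputable def e8D (f g : Module.Dual ℤ (Fin 8 → ℤ)) : Module.Dual ℤ (⋀[ℤ]^2 (Fin 8 → ℤ)) :=
  exteriorPower.pairingDual ℤ (Fin 8 → ℤ) 2 (exteriorPower.ιMulti ℤ 2 ![f, g])

lemma e8D_apply (f g : Module.Dual ℤ (Fin 8 → ℤ)) (a : Fin 2 → Fin 8 → ℤ) :
    e8D f g (exteriorPower.ιMulti ℤ 2 a) = f (a 0) * g (a 1) - g (a 0) * f (a 1) := by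
  simp [e8D, exteriorPower.pairingDual_ιMulti_ιMulti, Matrix.det_fin_two]

noncomputable def e8C : (⋀[ℤ]^2 (Fin 8 → ℤ)) →ₗ[ℤ] (⋀[ℤ]^2 (Fin 8 → ℤ)) →ₗ[ℤ] ℤ :=
  (exteriorPower.pairingDual ℤ (Fin 8 → ℤ) 2) ∘ₗ (exteriorPower.map 2 E8form)

lemma e8C_apply (a b : Fin 2 → Fin 8 → ℤ) :
    e8C (exteriorPower.ιMulti ℤ 2 a) (exteriorPower.ιMulti ℤ 2 b) =
      E8form (a 0) (b 0) * E8form (a 1) (b 1) - E8form (a 0) (b 1) * E8form (a 1) (b 0) := by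
  simp only [e8C, LinearMap.comp_apply, exteriorPower.map_apply_ιMulti]
  rw [exteriorPower.pairingDual_ιMulti_ιMulti]
  simp [Matrix.det_fin_two]
  ring

/-- The coordinate functionals of the frame. -/
noncomputable def e8s (i : Fin 8) : Module.Dual ℤ (Fin 8 → ℤ) :=
  (LinearMap.proj i) ∘ₗ e8S.mulVecLin

lemma e8s_apply (i : Fin 8) (v : Fin 8 → ℤ) : e8s i v = ∑ k, e8S i k * v k := by
  simp [e8s, Matrix.mulVec, dotProduct]

lemma e8_form_s (u v : Fin 8 → ℤ) : 2 * E8form u v = ∑ i, e8s i u * e8s i v := by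
  have h : ∑ i, e8s i u * e8s i v = dotProduct (e8S.mulVec u) (e8S.mulVec v) := rfl
  rw [h, Matrix.dotProduct_mulVec, Matrix.vecMul_mulVec, ← Matrix.dotProduct_mulVec, e8_StS,
    Matrix.smul_mulVec, dotProduct_smul, E8form, Matrix.toLinearMap₂'_apply', smul_eq_mul]

lemma e8C_frame (x y : ⋀[ℤ]^2 (Fin 8 → ℤ)) :
    8 * e8C x y = ∑ i, ∑ j, e8D (e8s i) (e8s j) x * e8D (e8s i) (e8s j) y := by
  have key : (8 : ℤ) • e8C = ∑ i, ∑ j,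
      (LinearMap.mul ℤ ℤ).compl₁₂ (e8D (e8s i) (e8s j)) (e8D (e8s i) (e8s j)) := by
    apply exteriorPower.linearMap_ext
    ext1 a
    apply exteriorPower.linearMap_ext
    ext1 b
    simp only [LinearMap.compAlternatingMap_apply, LinearMap.smul_apply, LinearMap.sum_apply,
      LinearMap.compl₁₂_apply, LinearMap.mul_apply', e8D_apply, e8C_apply, smul_eq_mul]
    have h := fun u v => e8_form_s u v
    have e : (8 : ℤ) * (E8form (a 0) (b 0) * E8form (a 1) (b 1) - E8form (a 0) (b 1) * E8form (a 1) (b 0))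
      = 2 * ((2 * E8form (a 0) (b 0)) * (2 * E8form (a 1) (b 1)) - (2 * E8form (a 0) (b 1)) * (2 * E8form (a 1) (b 0))) := by ring
    rw [e]
    simp only [h]
    rw [show ∀ p q : ℤ, 2 * (p - q) = p + p - q - q by intros; ring]
    nth_rewrite 2 [mul_comm (∑ i, e8s i (a 0) * e8s i (b 0))]
    nth_rewrite 2 [mul_comm (∑ i, e8s i (a 0) * e8s i (b 1))]
    simp only [Finset.sum_mul_sum, ← Finset.sum_add_distrib, ← Finset.sum_sub_distrib]
    refine Finset.sum_congr rfl fun i _ => Finset.sum_congr rfl fun j _ => ?_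
    ring
  have := congrArg (fun L => L x y) key
  simpa [LinearMap.sum_apply] using this

lemma e8B_eq (x : ⋀[ℤ]^2 (Fin 8 → ℤ)) (i j : Fin 8) :
    e8D (e8s i) (e8s j) x =
      ∑ l, (∑ k, e8S i k * e8D (LinearMap.proj k) (LinearMap.proj l) x) * e8S j l := by
  have key : e8D (e8s i) (e8s j) =
      ∑ l, ∑ k, (e8S i k * e8S j l) • e8D (LinearMap.proj k) (LinearMap.proj l) := by
    apply exteriorPower.linearMap_ext
    ext1 a
    simp only [LinearMap.compAlternatingMap_apply, LinearMap.smul_apply, LinearMap.sum_apply,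
      e8D_apply, smul_eq_mul, e8s_apply, LinearMap.proj_apply]
    rw [mul_comm (∑ k, e8S i k * a 0 k)]
    simp only [Finset.sum_mul_sum, ← Finset.sum_sub_distrib]
    refine Finset.sum_congr rfl fun l _ => Finset.sum_congr rfl fun k _ => ?_
    ring
  rw [key]
  simp only [LinearMap.sum_apply, LinearMap.smul_apply, smul_eq_mul, Finset.sum_mul]
  refine Finset.sum_congr rfl fun l _ => Finset.sum_congr rfl fun k _ => ?_
  ring

lemma e8D_swap (f g) (x : ⋀[ℤ]^2 (Fin 8 → ℤ)) : e8D g f x = - e8D f g x := by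
  have key : e8D g f = - e8D f g := by
    apply exteriorPower.linearMap_ext
    ext1 a
    simp only [LinearMap.compAlternatingMap_apply, LinearMap.neg_apply, e8D_apply]
    ring
  rw [key]; rfl

lemma e8form_surj : Function.Surjective E8form := by
  intro f
  have hdet : IsUnit CartanMatrix.E₈.det := by rw [CartanMatrix.E₈_det]; exact isUnit_one
  refine ⟨Matrix.vecMul (fun i => f (Pi.single i 1)) CartanMatrix.E₈⁻¹, ?_⟩
  apply LinearMap.pi_ext'
  intro i
  ext
  simp only [E8form, LinearMap.comp_apply, Matrix.toLinearMap₂'_apply', LinearMap.single_apply]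
  rw [Matrix.dotProduct_mulVec, Matrix.vecMul_vecMul, Matrix.nonsing_inv_mul _ hdet]
  simp

lemma e8C_bij : Function.Bijective e8C := by
  set b := (Pi.basisFun ℤ (Fin 8)).exteriorPower 2 with hb
  have hsurj : Function.Surjective e8C := by
    have h1 : Function.Surjective (exteriorPower.pairingDual ℤ (Fin 8 → ℤ) 2) := by
      rw [← LinearMap.range_eq_top, eq_top_iff, ← b.dualBasis.span_eq, Submodule.span_le]
      rintro _ ⟨s, rfl⟩
      refine ⟨exteriorPower.ιMulti_family ℤ 2 (Pi.basisFun ℤ (Fin 8)).coord s, ?_⟩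
      rw [Module.Basis.coe_dualBasis, hb, exteriorPower.basis_coord]
      rfl
    exact h1.comp (exteriorPower.map_surjective e8form_surj)
  refine ⟨?_, hsurj⟩
  have h2 : Function.Surjective (b.toDualEquiv.symm.toLinearMap ∘ₗ e8C) :=
    b.toDualEquiv.symm.surjective.comp hsurj
  have h3 := OrzechProperty.injective_of_surjective_endomorphism _ h2
  exact Function.Injective.of_comp (f := b.toDualEquiv.symm) h3

/-- **Statement 16.** The exterior square `Λ²(E₈)`, with the bilinear form
`(a₁∧a₂, b₁∧b₂) = (a₁,b₁)(a₂,b₂) − (a₁,b₂)(a₂,b₁)`, is a positive definite self dual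
(unimodular) lattice of rank `28` with no roots (no vectors of norm `2`).  In
particular there is a `28`-dimensional self dual positive definite lattice with no
roots. -/
theorem exterior_square_E8 :
    ∃ C : (⋀[ℤ]^2 (Fin 8 → ℤ)) →ₗ[ℤ] (⋀[ℤ]^2 (Fin 8 → ℤ)) →ₗ[ℤ] ℤ,
      (∀ a b : Fin 2 → (Fin 8 → ℤ),
        C (wedge ℤ 2 a) (wedge ℤ 2 b) =
          E8form (a 0) (b 0) * E8form (a 1) (b 1)
            - E8form (a 0) (b 1) * E8form (a 1) (b 0)) ∧
      Module.finrank ℤ (⋀[ℤ]^2 (Fin 8 → ℤ)) = 28 ∧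
      (∀ x : ⋀[ℤ]^2 (Fin 8 → ℤ), x ≠ 0 → 0 < C x x) ∧
      Function.Bijective C ∧
      (∀ x : ⋀[ℤ]^2 (Fin 8 → ℤ), C x x ≠ 2) := by
  refine ⟨e8C, fun a b => e8C_apply a b, ?_, ?_, e8C_bij, ?_⟩
  · rw [exteriorPower.finrank_eq]
    simp
    decide
  · intro x hx
    have h := e8C_frame x x
    by_contra hn
    have hz : ∑ i, ∑ j, e8D (e8s i) (e8s j) x * e8D (e8s i) (e8s j) x = 0 :=
      le_antisymm (by linarith)
        (Finset.sum_nonneg fun i _ => Finset.sum_nonneg fun j _ => mul_self_nonneg _)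
    have hz2 : ∀ i j, e8D (e8s i) (e8s j) x = 0 := by
      intro i j
      rw [Finset.sum_eq_zero_iff_of_nonneg
        (fun i _ => Finset.sum_nonneg fun j _ => mul_self_nonneg _)] at hz
      have := hz i (Finset.mem_univ _)
      rw [Finset.sum_eq_zero_iff_of_nonneg (fun j _ => mul_self_nonneg _)] at this
      exact mul_self_eq_zero.1 (this j (Finset.mem_univ _))
    apply hx
    apply e8C_bij.1
    rw [map_zero]
    apply LinearMap.ext
    intro y
    have := e8C_frame x y
    simp only [hz2, zero_mul, Finset.sum_const_zero] at this
    simp only [LinearMap.zero_apply]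
    linarith
  · intro x hx
    have h := e8C_frame x x
    rw [hx] at h
    refine e8_no_two (Matrix.of fun k l => e8D (LinearMap.proj k) (LinearMap.proj l) x)
      (Matrix.of fun i j => e8D (e8s i) (e8s j) x) (fun i j => e8D_swap _ _ x) ?_ ?_
    · ext i j
      simp only [Matrix.of_apply, Matrix.mul_apply, Matrix.transpose_apply]
      exact e8B_eq x i j
    · simp only [Matrix.of_apply, pow_two]
      linarith
end

section
/- Let E_8 be the E_8 root lattice, i.e., the even unimodular positive definite lattice of rank 8 (realized for instance as ℤ^8 with Gram matrix the Cartan matrix of type E_8), and equip the exterior square Λ²(E_8) with the bilinear form determined by (a_1∧a_2, b_1∧b_2) = (a_1,b_1)(a_2,b_2) − (a_1,b_2)(a_2,b_1). Then Λ²(E_8) contains exactly 2240 vectors λ with (λ, λ) = 3. -/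
namespace ExtE8

abbrev V8 := Fin 8 → ℤ
abbrev M8 := Matrix (Fin 8) (Fin 8) ℤ

/-- The Gram matrix. -/
abbrev G : M8 := CartanMatrix.E₈

/-- Codes of the 120 positive roots (decimal digits are the coefficients). -/
def posN : List ℕ :=
  [23465432, 23465431, 23465421, 23465321, 23464321, 23454321, 22454321, 23354321, 13354321, 
  22354321, 12354321, 22344321, 12344321, 22343321, 12244321, 12343321, 22343221, 12243321, 
  12343221, 22343211, 12233321, 12243221, 12343211, 22343210, 11233321, 12233221, 12243211, 
  12343210, 11233221, 12232221, 12233211, 12243210, 11232221, 11233211, 12232211, 12233210, 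
  11222221, 11232211, 11233210, 12232111, 12232210, 11122221, 11222211, 11232111, 11232210, 
  12232110, 1122221, 11122211, 11222111, 11222210, 11232110, 12232100, 1122211, 11122111, 
  11122210, 11221111, 11222110, 11232100, 1122111, 1122210, 11121111, 11122110, 11221110, 
  11222100, 1121111, 1122110, 11111111, 11121110, 11122100, 11221100, 1111111, 1121110, 1122100, 
  10111111, 11111110, 11121100, 11221000, 111111, 1011111, 1111110, 1121100, 10111110, 11111100, 
  11121000, 11111, 111110, 1011110, 1111100, 1121000, 10111100, 11111000, 1111, 11110, 111100, 
  1011100, 1111000, 10111000, 11110000, 111, 1110, 11100, 111000, 1011000, 1110000, 10110000, 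
  11, 110, 1100, 11000, 110000, 1010000, 10100000, 1, 10, 100, 1000, 10000, 100000, 1000000, 
  10000000]

def dec (n : ℕ) : V8 := fun i => ((n / 10 ^ (7 - (i : ℕ)) % 10 : ℕ) : ℤ)

def pos7 : List ℕ := posN.filter (fun n => n % 10 == 0)

def Ginv : M8 := !![4, 5, 7, 10, 8, 6, 4, 2; 5, 8, 10, 15, 12, 9, 6, 3;
  7, 10, 14, 20, 16, 12, 8, 4; 10, 15, 20, 30, 24, 18, 12, 6;
  8, 12, 16, 24, 20, 15, 10, 5; 6, 9, 12, 18, 15, 12, 8, 4;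
  4, 6, 8, 12, 10, 8, 6, 3; 2, 3, 4, 6, 5, 4, 3, 2]

/-- The rows are the vectors of an orthogonal frame of norm four vectors. -/
def Ht : M8 := !![0, 1, 1, 2, 2, 2, 2, 0; 0, 1, 1, 2, 2, 2, 0, 0;
  0, 1, 1, 2, 2, 0, 0, 0; 0, 1, 1, 2, 0, 0, 0, 0; 0, 1, 1, 0, 0, 0, 0, 0;
  0, -1, 1, 0, 0, 0, 0, 0; 4, 5, 7, 10, 8, 6, 4, 2; 0, 1, 1, 2, 2, 2, 2, 2]

def Ft : M8 := fun i j => if i < 6 then (Ht i j + Ht 6 j) / 2 else 0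

/-- fast bilinear form -/
def bf (a b : V8) : ℤ :=
  2 * (a 0 * b 0 + a 1 * b 1 + a 2 * b 2 + a 3 * b 3 + a 4 * b 4 + a 5 * b 5 + a 6 * b 6
    + a 7 * b 7) - (a 0 * b 2 + a 2 * b 0) - (a 1 * b 3 + a 3 * b 1) - (a 2 * b 3 + a 3 * b 2)
    - (a 3 * b 4 + a 4 * b 3) - (a 4 * b 5 + a 5 * b 4) - (a 5 * b 6 + a 6 * b 5)
    - (a 6 * b 7 + a 7 * b 6)

/-- simple reflections -/
def R (i : Fin 8) : M8 := fun j k => (if j = k then 1 else 0) - (if j = i then G i k else 0)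

theorem sum_pos : ∀ i j, (posN.map fun n => dec n i * dec n j).sum = 30 * Ginv i j := by
  decide +kernel

theorem sum_pos7 : ∀ i j, (pos7.map fun n => dec n i * dec n j).sum
    = 18 * Ginv i j - 9 * (dec 23465432 i * dec 23465432 j) := by
  decide +kernel

theorem G_symm : G.transpose = G := by decide +kernel
theorem Ginv_symm : Ginv.transpose = Ginv := by decide +kernel
theorem G_Ginv : G * Ginv = 1 := by decide +kernel
theorem Ht_G : Ht * G * Ht.transpose = (4 : ℤ) • (1 : M8) := by decide +kernel
theorem Ht_Ht : Ht.transpose * Ht * G = (4 : ℤ) • (1 : M8) := by decide +kernel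
theorem R_G : ∀ i, (R i).transpose * G * R i = G := by decide +kernel
theorem R_R : ∀ i, R i * R i = 1 := by decide +kernel
theorem R_top : ∀ i : Fin 8, i ≠ 7 → (R i).mulVec (dec 23465432) = dec 23465432 := by
  decide +kernel

theorem pos_raise : ∀ n ∈ posN, n = 23465432 ∨ ∃ i : Fin 8,
    (n + 10 ^ (7 - (i : ℕ))) ∈ posN ∧ (R i).mulVec (dec n) = dec (n + 10 ^ (7 - (i : ℕ))) := by
  decide +kernel

theorem pos7_raise : ∀ n ∈ pos7, n = 22343210 ∨ ∃ i : Fin 8, i ≠ 7 ∧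
    (n + 10 ^ (7 - (i : ℕ))) ∈ pos7 ∧ (R i).mulVec (dec n) = dec (n + 10 ^ (7 - (i : ℕ))) := by
  decide +kernel

theorem pos_le : ∀ n ∈ posN, n ≤ 23465432 := by decide +kernel
theorem pos_norm : ∀ n ∈ posN, bf (dec n) (dec n) = 2 := by decide +kernel

def dg (n k : ℕ) : ℕ := Nat.mod (Nat.div n k) 10

def dP (n m : ℕ) : ℕ := Nat.mul 2
  (Nat.add (Nat.mul (dg n 10000000) (dg m 10000000)) (Nat.add (Nat.mul (dg n 1000000) (dg m 1000000))
  (Nat.add (Nat.mul (dg n 100000) (dg m 100000)) (Nat.add (Nat.mul (dg n 10000) (dg m 10000))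
  (Nat.add (Nat.mul (dg n 1000) (dg m 1000)) (Nat.add (Nat.mul (dg n 100) (dg m 100))
  (Nat.add (Nat.mul (dg n 10) (dg m 10)) (Nat.mul (dg n 1) (dg m 1)))))))))

def dQ (n m : ℕ) : ℕ :=
  (Nat.add (Nat.mul (dg n 10000000) (dg m 100000))
  (Nat.add (Nat.mul (dg n 1000000) (dg m 10000))
  (Nat.add (Nat.mul (dg n 100000) (Nat.add (dg m 10000000) (dg m 10000)))
  (Nat.add (Nat.mul (dg n 10000) (Nat.add (dg m 1000000) (Nat.add (dg m 100000) (dg m 1000))))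
  (Nat.add (Nat.mul (dg n 1000) (Nat.add (dg m 10000) (dg m 100)))
  (Nat.add (Nat.mul (dg n 100) (Nat.add (dg m 1000) (dg m 10)))
  (Nat.add (Nat.mul (dg n 10) (Nat.add (dg m 100) (dg m 1))) (Nat.mul (dg n 1) (dg m 10)))))))))

def adj (n m : ℕ) : Bool := Nat.beq (Nat.succ (dP n m)) (dQ n m)

def pairs : List (ℕ × ℕ) := posN.flatMap fun a => (posN.filter fun b => adj a b).map fun b => (a, b)

theorem pairs_length : pairs.length = 2240 := by decide +kernel

theorem adj_iff (n m : ℕ) : adj n m = true ↔ bf (dec n) (dec m) = -1 := by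
  have e (n : ℕ) : dec n 0 = dg n 10000000 ∧ dec n 1 = dg n 1000000 ∧ dec n 2 = dg n 100000 ∧
      dec n 3 = dg n 10000 ∧ dec n 4 = dg n 1000 ∧ dec n 5 = dg n 100 ∧ dec n 6 = dg n 10 ∧
      dec n 7 = dg n 1 := ⟨rfl, rfl, rfl, rfl, rfl, rfl, rfl, rfl⟩
  obtain ⟨a0, a1, a2, a3, a4, a5, a6, a7⟩ := e n
  obtain ⟨b0, b1, b2, b3, b4, b5, b6, b7⟩ := e m
  unfold bf
  rw [a0, a1, a2, a3, a4, a5, a6, a7, b0, b1, b2, b3, b4, b5, b6, b7]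
  unfold adj dP dQ
  simp only [Nat.mul_eq, Nat.add_eq, Nat.beq_eq, Nat.succ_eq_add_one]
  constructor
  · intro h
    zify at h
    linarith
  · intro h
    zify
    linarith

def rc (n : ℕ) (i : Fin 8) : ℤ := ∑ j, G i j * dec n j

def rf (n : ℕ) (i : Fin 8) : ℕ := ((n : ℤ) - rc n i * 10 ^ (7 - (i : ℕ))).toNat

theorem refl_root : ∀ n ∈ posN, ∀ i : Fin 8, n = 10 ^ (7 - (i : ℕ)) ∨
    (rf n i ∈ posN ∧ ∀ j, dec n j - (if j = i then rc n i else 0) = dec (rf n i) j) := by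
  decide +kernel

theorem refl_simple : ∀ i : Fin 8, ∀ j, dec (10 ^ (7 - (i : ℕ))) j = if j = i then 1 else 0 := by
  decide +kernel

theorem pos_ht : ∀ n ∈ posN, 0 < ∑ i, dec n i := by decide +kernel
theorem pos_nodup : posN.Nodup := by decide +kernel
theorem posN_length : posN.length = 120 := by decide +kernel
theorem pos7_le : ∀ n ∈ pos7, n ≤ 22343210 := by decide +kernel

theorem pos7_length : pos7.length = 63 := by decide +kernel

def enumY : ℕ → ℕ → List (List ℕ)
  | 0, 0 => [[]]
  | 0, _ + 1 => []
  | n + 1, 0 => (enumY n 0).map (fun l => 0 :: l)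
  | n + 1, b + 1 => (enumY n (b + 1)).map (fun l => 0 :: l) ++ (enumY n b).map (fun l => 1 :: l)

def idx : Fin 8 → Fin 8 → ℕ := ![![0, 0, 1, 2, 3, 4, 0, 0], ![0, 0, 5, 6, 7, 8, 0, 0],
  ![0, 0, 0, 9, 10, 11, 0, 0], ![0, 0, 0, 0, 12, 13, 0, 0], ![0, 0, 0, 0, 0, 14, 0, 0],
  ![0, 0, 0, 0, 0, 0, 0, 0], ![0, 0, 0, 0, 0, 0, 0, 0], ![0, 0, 0, 0, 0, 0, 0, 0]]

def toY (l : List ℕ) (i j : Fin 8) : ℕ :=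
  if i < j ∧ j < 6 then l.getD (idx i j) 0 else if j < i ∧ i < 6 then l.getD (idx j i) 0 else 0

def triples : List (Fin 8 × Fin 8 × Fin 8) :=
  [(0,1,2),(0,1,3),(0,1,4),(0,1,5),(0,2,3),(0,2,4),(0,2,5),(0,3,4),(0,3,5),(0,4,5),
   (1,2,3),(1,2,4),(1,2,5),(1,3,4),(1,3,5),(1,4,5),(2,3,4),(2,3,5),(2,4,5),(3,4,5)]

def inT (t : Fin 8 × Fin 8 × Fin 8) (i : Fin 8) : Bool := i == t.1 || (i == t.2.1 || i == t.2.2)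

def triY (t : Fin 8 × Fin 8 × Fin 8) (i j : Fin 8) : ℕ :=
  if i ≠ j ∧ inT t i = true ∧ inT t j = true then 1 else 0

theorem enum_good : ∀ l ∈ enumY 15 3, (∀ i : Fin 6, (∑ j : Fin 6,
      toY l (i.castLE (by norm_num)) (j.castLE (by norm_num))) % 2 = 0) →
    ∃ t ∈ triples, ∀ i j, toY l i j = triY t i j := by
  decide +kernel

theorem triples_ne : ∀ t ∈ triples, t.1 ≠ t.2.1 ∧ t.2.1 ≠ t.2.2 ∧ t.1 ≠ t.2.2 := by
  decide +kernel

def coefs : List (ℤ × ℤ × ℤ × ℤ) :=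
  [(1,0,0,1),(0,1,-1,-1),(-1,-1,1,0),(-1,0,0,-1),(0,-1,1,1),(1,1,-1,0),
   (1,0,-1,1),(0,1,-1,0),(-1,1,0,-1),(-1,0,1,-1),(0,-1,1,0),(1,-1,0,1)]

theorem coefs_det : ∀ c ∈ coefs, c.1 * c.2.2.2 - c.2.1 * c.2.2.1 = 1 := by decide +kernel

def cd (x : V8) : ℕ := ((∑ i : Fin 8, x i * 10 ^ (7 - (i : ℕ))) / 2).toNat

def tA (t : Fin 8 × Fin 8 × Fin 8) (p q : ℤ) : V8 := fun i => Ht t.1 i - p * q * Ht t.2.2 i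
def tB (t : Fin 8 × Fin 8 × Fin 8) (p s : ℤ) : V8 := fun i => p * Ht t.2.1 i + s * Ht t.2.2 i
def lc (c d : ℤ) (x y : V8) : V8 := fun i => c * x i + d * y i

theorem tri_root : ∀ t ∈ triples, ∀ p ∈ [(1 : ℤ), -1], ∀ q ∈ [(1 : ℤ), -1], ∀ s ∈ [(1 : ℤ), -1],
    ∃ c ∈ coefs,
      cd (lc c.1 c.2.1 (tA t p q) (tB t p s)) ∈ posN ∧
      cd (lc c.2.2.1 c.2.2.2 (tA t p q) (tB t p s)) ∈ posN ∧
      adj (cd (lc c.1 c.2.1 (tA t p q) (tB t p s)))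
        (cd (lc c.2.2.1 c.2.2.2 (tA t p q) (tB t p s))) = true ∧
      (∀ i, 2 * dec (cd (lc c.1 c.2.1 (tA t p q) (tB t p s))) i
        = lc c.1 c.2.1 (tA t p q) (tB t p s) i) ∧
      (∀ i, 2 * dec (cd (lc c.2.2.1 c.2.2.2 (tA t p q) (tB t p s))) i
        = lc c.2.2.1 c.2.2.2 (tA t p q) (tB t p s) i) := by
  decide +kernel

/-- difference between twice `F` and `H` as combination of the two killed roots -/
def Dc : Matrix (Fin 8) (Fin 2) ℤ :=
  !![1, 1; 1, 1; 1, 1; 1, 1; 1, 1; 1, 1; -1, -1; -1, 1]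
def K2 : Matrix (Fin 2) (Fin 8) ℤ := !![2, 3, 4, 6, 5, 4, 3, 2; 2, 2, 3, 4, 3, 2, 1, 0]

theorem F_H : (2 : ℤ) • Ft = Ht + Dc * K2 := by decide +kernel
theorem K2_eq : K2 0 = dec 23465432 ∧ K2 1 = dec 22343210 := by decide +kernel
def sp : V8 := ![2, 4, 6, 8, 6, 4, 2, 0]
theorem F_one : ∀ j, ∑ i, Ft i j = sp j + 3 * K2 0 j + 2 * K2 1 j := by decide +kernel
theorem sp_even : ∀ j, sp j = 2 * (![1, 2, 3, 4, 3, 2, 1, 0] : V8) j := by decide +kernel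

open Matrix

/-- the alternating matrix of a wedge -/
def w (a b : V8) : M8 := Matrix.vecMulVec a b - Matrix.vecMulVec b a

theorem w_apply (a b : V8) (i j : Fin 8) : w a b i j = a i * b j - b i * a j := rfl

theorem w_conj (P : M8) (a b : V8) : P * w a b * Pᵀ = w (P *ᵥ a) (P *ᵥ b) := by
  unfold w
  rw [mul_sub, sub_mul, Matrix.mul_vecMulVec, Matrix.mul_vecMulVec, Matrix.vecMulVec_mul,
    Matrix.vecMulVec_mul, Matrix.vecMul_transpose, Matrix.vecMul_transpose]

theorem bf_eq (a b : V8) : bf a b = a ⬝ᵥ (G *ᵥ b) := by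
  simp [bf, dotProduct, Matrix.mulVec, Fin.sum_univ_eight, G, CartanMatrix.E₈]
  ring

theorem bf_symm (a b : V8) : bf a b = bf b a := by unfold bf; ring

theorem w_skew (a b : V8) : (w a b)ᵀ = - w a b := by
  ext i j; simp only [Matrix.transpose_apply, Matrix.neg_apply, w_apply]; ring

theorem vec_tr (a b c d : V8) : (Matrix.vecMulVec a b * G * Matrix.vecMulVec c d * G).trace
    = bf b c * bf d a := by
  rw [Matrix.vecMulVec_mul, Matrix.vecMulVec_mul_vecMulVec, Matrix.vecMulVec_mul,
    Matrix.smul_vecMul, Matrix.trace_vecMulVec, dotProduct_smul, bf_eq, bf_eq,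
    Matrix.dotProduct_mulVec, Matrix.dotProduct_mulVec, smul_eq_mul, dotProduct_comm a]

theorem w_tr (a b c d : V8) : (w a b * G * w c d * G).trace
    = -2 * (bf a c * bf b d - bf a d * bf b c) := by
  unfold w
  simp only [sub_mul, mul_sub, Matrix.trace_sub, vec_tr]
  rw [bf_symm d a, bf_symm d b, bf_symm c b, bf_symm c a]
  ring

theorem w_mulVec (a b v : V8) : w a b *ᵥ (G *ᵥ v) = bf b v • a - bf a v • b := by
  ext i
  simp only [w, Matrix.sub_mulVec, Matrix.vecMulVec_mulVec, bf_eq, Pi.sub_apply, Pi.smul_apply,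
    MulOpposite.smul_eq_mul_unop, MulOpposite.unop_op, smul_eq_mul]
  ring

theorem bf_conj (i : Fin 8) (a b : V8) : bf (R i *ᵥ a) (R i *ᵥ b) = bf a b := by
  rw [bf_eq, bf_eq]
  conv_rhs => rw [← R_G i]
  simp only [← Matrix.mulVec_mulVec, Matrix.dotProduct_mulVec, Matrix.vecMul_transpose]

theorem bf_small (v : V8) (h : bf v v < 2) : v = 0 := by
  have h1 : (Ht *ᵥ (G *ᵥ v)) ⬝ᵥ (Ht *ᵥ (G *ᵥ v)) = 4 * bf v v := by
    have : Htᵀ *ᵥ (Ht *ᵥ (G *ᵥ v)) = (4 : ℤ) • v := by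
      rw [Matrix.mulVec_mulVec, Matrix.mulVec_mulVec, Ht_Ht, Matrix.smul_mulVec, Matrix.one_mulVec]
    rw [Matrix.dotProduct_mulVec, ← Matrix.mulVec_transpose, this, smul_dotProduct, ← bf_eq,
      smul_eq_mul]
  have h2 : 0 ≤ (Ht *ᵥ (G *ᵥ v)) ⬝ᵥ (Ht *ᵥ (G *ᵥ v)) :=
    Finset.sum_nonneg fun i _ => mul_self_nonneg _
  have h3 : bf v v = 2 * (v 0 * v 0 + v 1 * v 1 + v 2 * v 2 + v 3 * v 3 + v 4 * v 4 + v 5 * v 5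
      + v 6 * v 6 + v 7 * v 7 - v 0 * v 2 - v 1 * v 3 - v 2 * v 3 - v 3 * v 4 - v 4 * v 5
      - v 5 * v 6 - v 6 * v 7) := by unfold bf; ring
  have h4 : bf v v = 0 := by omega
  rw [h4, mul_zero] at h1
  have h5 := dotProduct_self_eq_zero.1 h1
  have : Htᵀ *ᵥ (Ht *ᵥ (G *ᵥ v)) = (4 : ℤ) • v := by
    rw [Matrix.mulVec_mulVec, Matrix.mulVec_mulVec, Ht_Ht, Matrix.smul_mulVec, Matrix.one_mulVec]
  rw [h5, Matrix.mulVec_zero] at this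
  ext i
  have := congrFun this i
  simpa using this.symm

theorem list_quad (l : List ℕ) (K : M8) : (l.map fun n => dec n ⬝ᵥ (K *ᵥ dec n)).sum
    = ∑ i, ∑ j, K i j * (l.map fun n => dec n i * dec n j).sum := by
  induction l with
  | nil => simp
  | cons a l ih =>
    simp only [List.map_cons, List.sum_cons, ih, mul_add, Finset.sum_add_distrib]
    congr 1
    simp only [dotProduct, Matrix.mulVec, Finset.mul_sum]
    refine Finset.sum_congr rfl fun i _ => Finset.sum_congr rfl fun j _ => ?_
    ring

theorem list_small (l : List ℕ) (f : ℕ → ℤ) (h : (l.map f).sum < 2 * l.length) :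
    ∃ n ∈ l, f n < 2 := by
  by_contra! hc
  induction l with
  | nil => simp at h
  | cons a l ih =>
    simp only [List.map_cons, List.sum_cons, List.length_cons] at h
    have := hc a (by simp)
    push_cast at h
    exact ih (by linarith) (fun n hn => hc n (by simp [hn]))

/-- quadratic form of images -/
theorem img_norm (M : M8) (hs : Mᵀ = -M) (v : V8) :
    bf (M *ᵥ (G *ᵥ v)) (M *ᵥ (G *ᵥ v)) = v ⬝ᵥ ((-(G * M * G * M * G)) *ᵥ v) := by
  have e : -(G * M * G * M * G) = (Gᵀ * Mᵀ) * (G * M * G) := by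
    rw [hs, G_symm]; simp only [Matrix.mul_neg, Matrix.neg_mul, Matrix.mul_assoc]
  rw [e, bf_eq, ← Matrix.mulVec_mulVec (M := Gᵀ * Mᵀ), Matrix.dotProduct_mulVec v,
    ← Matrix.vecMul_vecMul, Matrix.vecMul_transpose, Matrix.vecMul_transpose]
  simp only [Matrix.mulVec_mulVec, Matrix.mul_assoc]

theorem sum_Ginv (M : M8) :
    ∑ i, ∑ j, (-(G * M * G * M * G)) i j * Ginv i j = - (M * G * M * G).trace := by
  have : ∑ i, ∑ j, (-(G * M * G * M * G)) i j * Ginv i j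
      = ((-(G * M * G * M * G)) * Ginvᵀ).trace := by
    simp [Matrix.trace, Matrix.mul_apply]
  rw [this, Ginv_symm, Matrix.neg_mul, Matrix.trace_neg, Matrix.mul_assoc _ G Ginv, G_Ginv,
    mul_one, Matrix.mul_assoc, Matrix.mul_assoc, Matrix.trace_mul_comm]
  simp only [Matrix.mul_assoc]

theorem exists_root (M : M8) (hs : Mᵀ = -M) (ht : (M * G * M * G).trace = -6) :
    ∃ n ∈ posN, M *ᵥ (G *ᵥ dec n) = 0 := by
  have h := list_quad posN (-(G * M * G * M * G))
  simp only [sum_pos, mul_left_comm _ (30 : ℤ), ← Finset.mul_sum, sum_Ginv, ht] at h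
  obtain ⟨n, hn, h2⟩ := list_small posN _ (by rw [h, posN_length]; norm_num)
  rw [← img_norm M hs] at h2
  exact ⟨n, hn, bf_small _ h2⟩

theorem exists_root7 (M : M8) (hs : Mᵀ = -M) (ht : (M * G * M * G).trace = -6)
    (h0 : M *ᵥ (G *ᵥ dec 23465432) = 0) :
    ∃ n ∈ pos7, M *ᵥ (G *ᵥ dec n) = 0 := by
  have h := list_quad pos7 (-(G * M * G * M * G))
  have h1 : ∑ i, ∑ j, (-(G * M * G * M * G)) i j * (dec 23465432 i * dec 23465432 j) = 0 := by
    have := img_norm M hs (dec 23465432)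
    rw [h0] at this
    simp only [dotProduct, Matrix.mulVec, Finset.mul_sum] at this
    have e0 : bf 0 0 = 0 := by simp [bf]
    rw [e0] at this
    rw [this]
    refine Finset.sum_congr rfl fun i _ => Finset.sum_congr rfl fun j _ => ?_
    ring
  simp only [sum_pos7, mul_sub, mul_left_comm _ (18 : ℤ), mul_left_comm _ (9 : ℤ),
    Finset.sum_sub_distrib, ← Finset.mul_sum, sum_Ginv, ht, h1] at h
  obtain ⟨n, hn, h2⟩ := list_small pos7 _ (by rw [h, pos7_length]; norm_num)
  rw [← img_norm M hs] at h2
  exact ⟨n, hn, bf_small _ h2⟩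

def Good (M : M8) : Prop := ∃ n ∈ posN, ∃ m ∈ posN, adj n m = true ∧ M = w (dec n) (dec m)

theorem R_mulVec (i : Fin 8) (v : V8) (j : Fin 8) :
    (R i *ᵥ v) j = v j - if j = i then ∑ k, G i k * v k else 0 := by
  simp only [R, Matrix.mulVec, dotProduct, sub_mul, Finset.sum_sub_distrib]
  congr 1
  · simp
  · split_ifs <;> simp

theorem refl_root' (n : ℕ) (hn : n ∈ posN) (i : Fin 8) : n = 10 ^ (7 - (i : ℕ)) ∨
    (∃ m ∈ posN, R i *ᵥ dec n = dec m) := by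
  rcases refl_root n hn i with h | ⟨h1, h2⟩
  · exact Or.inl h
  · refine Or.inr ⟨_, h1, ?_⟩
    ext j
    rw [R_mulVec, ← h2 j]
    rfl

theorem refl_wedge (i : Fin 8) (m : ℕ) (h : bf (dec (10 ^ (7 - (i : ℕ)))) (dec m) = -1) :
    w (R i *ᵥ dec (10 ^ (7 - (i : ℕ)))) (R i *ᵥ dec m) = w (dec m) (dec (10 ^ (7 - (i : ℕ)))) := by
  have e := refl_simple i
  set a := dec (10 ^ (7 - (i : ℕ))) with ha
  have key : ∀ v : V8, R i *ᵥ v = v - bf a v • a := by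
    intro v
    ext j
    rw [R_mulVec, bf_eq]
    simp only [Pi.sub_apply, Pi.smul_apply, e, smul_eq_mul, dotProduct, Matrix.mulVec]
    simp
  have haa : bf a a = 2 := by
    rw [bf_eq]
    have : a = Pi.single i 1 := by
      ext j; rw [e, Pi.single_apply]
    rw [this]
    simp
  rw [key, key, h, haa]
  ext x y
  simp only [w_apply, Pi.sub_apply, Pi.smul_apply, smul_eq_mul]
  ring

theorem w_swap (a b : V8) : w a b = - w b a := by
  ext x y; simp only [w_apply, Matrix.neg_apply]; ring

theorem Good.refl {M : M8} (h : Good M) (i : Fin 8) : Good (R i * M * (R i)ᵀ) := by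
  obtain ⟨n, hn, m, hm, hb, rfl⟩ := h
  rw [w_conj]
  rw [adj_iff] at hb
  rcases refl_root' n hn i with h | ⟨n', hn', h'⟩
  · subst h
    refine ⟨m, hm, _, hn, ?_, refl_wedge i m hb⟩
    rw [adj_iff, bf_symm, hb]
  · rcases refl_root' m hm i with h2 | ⟨m', hm', h2'⟩
    · subst h2
      refine ⟨_, hm, n, hn, ?_, ?_⟩
      · rw [adj_iff, bf_symm, hb]
      · rw [w_swap, refl_wedge i n (by rw [bf_symm, hb]), ← w_swap]
    · refine ⟨n', hn', m', hm', ?_, by rw [h', h2']⟩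
      rw [adj_iff, ← h', ← h2', bf_conj, hb]

theorem conj_skew {M : M8} (h : Mᵀ = -M) (P : M8) : (P * M * Pᵀ)ᵀ = -(P * M * Pᵀ) := by
  simp only [Matrix.transpose_mul, Matrix.transpose_transpose, h, Matrix.mul_assoc, Matrix.neg_mul,
    Matrix.mul_neg]

theorem conj_tr (M : M8) (i : Fin 8) :
    ((R i * M * (R i)ᵀ) * G * (R i * M * (R i)ᵀ) * G).trace = (M * G * M * G).trace := by
  have : (R i * M * (R i)ᵀ) * G * (R i * M * (R i)ᵀ) * G
      = R i * (M * ((R i)ᵀ * G * R i) * M * ((R i)ᵀ * G)) := by simp only [Matrix.mul_assoc]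
  rw [this, R_G, Matrix.trace_mul_comm, Matrix.mul_assoc _ _ (R i), R_G]

theorem conj_conj (M : M8) (i : Fin 8) : R i * (R i * M * (R i)ᵀ) * (R i)ᵀ = M := by
  have : R i * (R i * M * (R i)ᵀ) * (R i)ᵀ = (R i * R i) * M * (R i * R i)ᵀ := by
    simp only [Matrix.transpose_mul, Matrix.mul_assoc]
  rw [this, R_R]; simp

theorem conj_ker (M : M8) (i : Fin 8) (v : V8) (h : M *ᵥ (G *ᵥ v) = 0) :
    (R i * M * (R i)ᵀ) *ᵥ (G *ᵥ (R i *ᵥ v)) = 0 := by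
  have : (R i * M * (R i)ᵀ) *ᵥ (G *ᵥ (R i *ᵥ v))
      = R i *ᵥ (M *ᵥ (((R i)ᵀ * G * R i) *ᵥ v)) := by
    simp only [Matrix.mulVec_mulVec, Matrix.mul_assoc]
  rw [this, R_G, h, Matrix.mulVec_zero]

set_option linter.unusedSimpArgs false

theorem enumY_mem (l : List ℕ) (hl : ∀ x ∈ l, x = 0 ∨ x = 1) : l ∈ enumY l.length l.sum := by
  induction l with
  | nil => simp [enumY]
  | cons a l ih =>
    have ih := ih (fun x hx => hl x (by simp [hx]))
    rcases hl a (by simp) with h | h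
    · subst h
      simp only [List.length_cons, List.sum_cons, zero_add]
      generalize l.sum = s at ih
      cases s <;> simp [enumY, ih]
    · subst h
      simp only [List.length_cons, List.sum_cons, add_comm 1]
      simp [enumY, ih]

theorem toY_eq (A : Fin 8 → Fin 8 → ℕ) (hA0 : ∀ i, A i i = 0) (hA6 : ∀ i, A i 6 = 0)
    (hA7 : ∀ i, A i 7 = 0) (hA6' : ∀ i, A 6 i = 0) (hA7' : ∀ i, A 7 i = 0)
    (hAs : ∀ i j, A i j = A j i) : ∀ i j, toY [A 0 1, A 0 2, A 0 3, A 0 4, A 0 5, A 1 2, A 1 3,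
      A 1 4, A 1 5, A 2 3, A 2 4, A 2 5, A 3 4, A 3 5, A 4 5] i j = A i j := by
  intro i j
  fin_cases i <;> fin_cases j <;> first
    | rfl
    | exact (hA0 _).symm
    | exact (hA6 _).symm
    | exact (hA7 _).symm
    | exact (hA6' _).symm
    | exact (hA7' _).symm
    | exact hAs _ _

set_option maxHeartbeats 1000000 in
/-- combinatorial classification of the coordinate matrix -/
theorem Z_class (Z : M8) (hs : Zᵀ = -Z) (ht : (Z * Z).trace = -6)
    (h6 : ∀ i, Z i 6 = 0) (h7 : ∀ i, Z i 7 = 0) (hp : ∀ i, (∑ j, Z i j) % 2 = 0) :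
    ∃ t ∈ triples, ∀ i j, (Z i j).natAbs = triY t i j := by
  have sk : ∀ i j, Z j i = - Z i j := fun i j => by
    have := congrFun (congrFun hs i) j
    simpa using this
  have hd : ∀ i, Z i i = 0 := fun i => by have := sk i i; omega
  let A : Fin 8 → Fin 8 → ℕ := fun i j => (Z i j).natAbs
  have hAs : ∀ i j, A i j = A j i := fun i j => by simp only [A, sk i j, Int.natAbs_neg]
  have hq : A 0 1 ^ 2 + A 0 2 ^ 2 + A 0 3 ^ 2 + A 0 4 ^ 2 + A 0 5 ^ 2 + A 1 2 ^ 2 + A 1 3 ^ 2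
      + A 1 4 ^ 2 + A 1 5 ^ 2 + A 2 3 ^ 2 + A 2 4 ^ 2 + A 2 5 ^ 2 + A 3 4 ^ 2 + A 3 5 ^ 2
      + A 4 5 ^ 2 = 3 := by
    zify
    simp only [A, Int.natCast_natAbs, sq_abs]
    have h61 : ∀ i, Z 6 i = 0 := fun i => by rw [sk i 6, h6, neg_zero]
    have h71 : ∀ i, Z 7 i = 0 := fun i => by rw [sk i 7, h7, neg_zero]
    simp only [Matrix.trace, Matrix.diag, Matrix.mul_apply, Fin.sum_univ_eight, h6, h7, h61, h71,
      hd] at ht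
    rw [sk 0 1, sk 0 2, sk 0 3, sk 0 4, sk 0 5, sk 1 2, sk 1 3, sk 1 4, sk 1 5, sk 2 3, sk 2 4,
      sk 2 5, sk 3 4, sk 3 5, sk 4 5] at ht
    linarith
  have le1 : ∀ x : ℕ, x ^ 2 ≤ 3 → x = 0 ∨ x = 1 := fun x hx => by
    have : x < 2 := by nlinarith
    omega
  have e01 := le1 (A 0 1) (by omega)
  have e02 := le1 (A 0 2) (by omega)
  have e03 := le1 (A 0 3) (by omega)
  have e04 := le1 (A 0 4) (by omega)
  have e05 := le1 (A 0 5) (by omega)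
  have e12 := le1 (A 1 2) (by omega)
  have e13 := le1 (A 1 3) (by omega)
  have e14 := le1 (A 1 4) (by omega)
  have e15 := le1 (A 1 5) (by omega)
  have e23 := le1 (A 2 3) (by omega)
  have e24 := le1 (A 2 4) (by omega)
  have e25 := le1 (A 2 5) (by omega)
  have e34 := le1 (A 3 4) (by omega)
  have e35 := le1 (A 3 5) (by omega)
  have e45 := le1 (A 4 5) (by omega)
  have sq1 : ∀ x : ℕ, (x = 0 ∨ x = 1) → x ^ 2 = x := by rintro x (rfl | rfl) <;> norm_num
  rw [sq1 _ e01, sq1 _ e02, sq1 _ e03, sq1 _ e04, sq1 _ e05, sq1 _ e12, sq1 _ e13, sq1 _ e14,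
    sq1 _ e15, sq1 _ e23, sq1 _ e24, sq1 _ e25, sq1 _ e34, sq1 _ e35, sq1 _ e45] at hq
  have hA0 : ∀ i, A i i = 0 := fun i => by simp only [A, hd, Int.natAbs_zero]
  have hA6 : ∀ i, A i 6 = 0 := fun i => by simp only [A, h6, Int.natAbs_zero]
  have hA7 : ∀ i, A i 7 = 0 := fun i => by simp only [A, h7, Int.natAbs_zero]
  have hA6' : ∀ i, A 6 i = 0 := fun i => by rw [hAs, hA6]
  have hA7' : ∀ i, A 7 i = 0 := fun i => by rw [hAs, hA7]
  have hP : ∀ i, (∑ j, A i j) % 2 = 0 := by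
    intro i
    have := hp i
    simp only [Fin.sum_univ_eight, A] at this ⊢
    omega
  let l : List ℕ := [A 0 1, A 0 2, A 0 3, A 0 4, A 0 5, A 1 2, A 1 3, A 1 4, A 1 5, A 2 3, A 2 4,
    A 2 5, A 3 4, A 3 5, A 4 5]
  have hY : ∀ i j, toY l i j = A i j := by
    exact toY_eq A hA0 hA6 hA7 hA6' hA7' hAs
  have hl : l ∈ enumY 15 3 := by
    have h15 : l.length = 15 := rfl
    have h3 : l.sum = 3 := by
      simp only [l, List.sum_cons, List.sum_nil]
      omega
    have := enumY_mem l (by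
      simp only [l, List.forall_mem_cons]
      exact ⟨e01, e02, e03, e04, e05, e12, e13, e14, e15, e23, e24, e25, e34, e35, e45, by simp⟩)
    rwa [h15, h3] at this
  obtain ⟨t, ht, h⟩ := enum_good l hl (by
    intro i
    simp only [hY]
    have := hP (i.castLE (by norm_num))
    rw [Fin.sum_univ_eight, hA6, hA7] at this
    rw [Fin.sum_univ_six]
    exact this)
  exact ⟨t, ht, fun i j => by rw [← h, hY]⟩

theorem Z_form (Z : M8) (hs : Zᵀ = -Z) (t : Fin 8 × Fin 8 × Fin 8) (ht : t ∈ triples)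
    (h : ∀ i j, (Z i j).natAbs = triY t i j) :
    Z = Z t.1 t.2.1 • w (Pi.single t.1 1) (Pi.single t.2.1 1)
      + Z t.2.1 t.2.2 • w (Pi.single t.2.1 1) (Pi.single t.2.2 1)
      + Z t.1 t.2.2 • w (Pi.single t.1 1) (Pi.single t.2.2 1) := by
  have sk : ∀ i j, Z j i = - Z i j := fun i j => by
    have := congrFun (congrFun hs i) j
    simpa using this
  have hd : ∀ i, Z i i = 0 := fun i => by have := sk i i; omega
  obtain ⟨n1, n2, n3⟩ := triples_ne t ht
  obtain ⟨a, b, c⟩ := t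
  simp only at n1 n2 n3 ⊢
  have hz : ∀ i j, (inT (a, b, c) i = false ∨ inT (a, b, c) j = false) → Z i j = 0 := by
    intro i j hij
    have := h i j
    rw [triY, if_neg (by rcases hij with h | h <;> simp [h])] at this
    omega
  have hf : ∀ i, i ≠ a → i ≠ b → i ≠ c → inT (a, b, c) i = false := by
    intro i h1 h2 h3
    simp [inT, h1, h2, h3]
  ext i j
  simp only [Matrix.add_apply, Matrix.smul_apply, w_apply, Pi.single_apply, smul_eq_mul]
  by_cases ia : i = a
  · subst ia
    by_cases ja : j = i
    · subst ja; simp [hd, n1, n3]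
    by_cases jb : j = b
    · subst jb; simp [n1, n2, n3, n1.symm, n2.symm, n3.symm]
    by_cases jc : j = c
    · subst jc; simp [n1, n2, n3, n1.symm, n2.symm, n3.symm]
    rw [hz _ _ (Or.inr (hf j ja jb jc))]; simp [ja, jb, jc]
  by_cases ib : i = b
  · subst ib
    by_cases ja : j = a
    · subst ja; rw [sk]; simp [n1, n2, n3, n1.symm, n2.symm, n3.symm]
    by_cases jb : j = i
    · subst jb; simp [hd, n1, n2, n3, n1.symm, n2.symm, n3.symm]
    by_cases jc : j = c
    · subst jc; simp [n1, n2, n3, n1.symm, n2.symm, n3.symm]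
    rw [hz _ _ (Or.inr (hf j ja jb jc))]; simp [ja, jb, jc]
  by_cases ic : i = c
  · subst ic
    by_cases ja : j = a
    · subst ja; rw [sk]; simp [n1, n2, n3, n1.symm, n2.symm, n3.symm]
    by_cases jb : j = b
    · subst jb; rw [sk]; simp [n1, n2, n3, n1.symm, n2.symm, n3.symm]
    by_cases jc : j = i
    · subst jc; simp [hd, n1, n2, n3, n1.symm, n2.symm, n3.symm]
    rw [hz _ _ (Or.inr (hf j ja jb jc))]; simp [ja, jb, jc]
  rw [hz _ _ (Or.inl (hf i ia ib ic))]; simp [ia, ib, ic]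

theorem four_cancel {A B : M8} (h : (4 : ℤ) • A = (4 : ℤ) • B) : A = B := by
  ext i j
  have := congrFun (congrFun h i) j
  simp only [Matrix.smul_apply, smul_eq_mul] at this
  omega

theorem base (M : M8) (hs : Mᵀ = -M) (ht : (M * G * M * G).trace = -6)
    (h0 : M *ᵥ (G *ᵥ dec 23465432) = 0) (h1 : M *ᵥ (G *ᵥ dec 22343210) = 0) : Good M := by
  have hK : M * G * K2ᵀ = 0 := by
    ext i j
    have : (M * G * K2ᵀ) i j = (M *ᵥ (G *ᵥ K2 j)) i := by
      rw [Matrix.mulVec_mulVec]; rfl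
    rw [this]
    fin_cases j
    · simp only [Fin.zero_eta]; rw [K2_eq.1, h0]; rfl
    · simp only [Fin.mk_one]; rw [K2_eq.2, h1]; rfl
  have hK' : K2 * G * M = 0 := by
    have := congrArg Matrix.transpose hK
    simp only [Matrix.transpose_mul, Matrix.transpose_transpose, hs, G_symm, Matrix.mul_neg,
      Matrix.transpose_zero, neg_eq_zero, ← Matrix.mul_assoc] at this
    exact this
  let Z : M8 := Ft * G * M * G * Ftᵀ
  have hZs : Zᵀ = -Z := by
    simp only [Z, Matrix.transpose_mul, Matrix.transpose_transpose, hs, G_symm, Matrix.mul_neg,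
      Matrix.neg_mul, Matrix.mul_assoc]
  have hW : Ht * G * M * G * Htᵀ = (4 : ℤ) • Z := by
    have e : Ht = (2 : ℤ) • Ft - Dc * K2 := by rw [F_H]; simp
    have e1 : Ht * G * M = (2 : ℤ) • (Ft * G * M) := by
      rw [e, Matrix.sub_mul, Matrix.sub_mul, Matrix.mul_assoc Dc, Matrix.mul_assoc Dc, hK', Matrix.mul_zero,
        sub_zero, Matrix.smul_mul, Matrix.smul_mul]
    have e2 : M * G * Htᵀ = (2 : ℤ) • (M * G * Ftᵀ) := by
      rw [e, Matrix.transpose_sub, Matrix.mul_sub, Matrix.transpose_mul, ← Matrix.mul_assoc _ K2ᵀ,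
        hK, Matrix.zero_mul, sub_zero, Matrix.transpose_smul, Matrix.mul_smul]
    rw [e1, Matrix.smul_mul, Matrix.smul_mul, Matrix.mul_assoc (Ft * G), Matrix.mul_assoc (Ft * G),
      e2]
    simp only [Z, Matrix.mul_smul, smul_smul, Matrix.mul_assoc]
    norm_num
  have hHt' : G * Htᵀ * Ht = (4 : ℤ) • (1 : M8) := by
    have := congrArg Matrix.transpose Ht_Ht
    simp only [Matrix.transpose_mul, Matrix.transpose_transpose, G_symm, Matrix.transpose_smul,
      Matrix.transpose_one, ← Matrix.mul_assoc] at this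
    exact this
  have hM : (4 : ℤ) • M = Htᵀ * Z * Ht := by
    apply four_cancel
    have : (4 : ℤ) • (Htᵀ * Z * Ht) = (Htᵀ * Ht * G) * M * (G * Htᵀ * Ht) := by
      have : (4 : ℤ) • (Htᵀ * Z * Ht) = Htᵀ * ((4 : ℤ) • Z) * Ht := by
        rw [Matrix.mul_smul, Matrix.smul_mul]
      rw [this, ← hW]
      simp only [Matrix.mul_assoc]
    rw [this, Ht_Ht, hHt', Matrix.mul_smul, Matrix.smul_mul, Matrix.one_mul, Matrix.mul_one]
  have hZt : (Z * Z).trace = -6 := by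
    have e : ((4 : ℤ) • M) * G * ((4 : ℤ) • M) * G
        = Htᵀ * (Z * (Ht * G * Htᵀ) * Z * (Ht * G)) := by
      rw [hM]; simp only [Matrix.mul_assoc]
    have := congrArg Matrix.trace e
    rw [Matrix.trace_mul_comm Htᵀ, Matrix.mul_assoc _ (Ht * G), Ht_G] at this
    simp only [Matrix.smul_mul, Matrix.mul_smul, Matrix.trace_smul, Matrix.mul_one, ht,
      smul_eq_mul] at this
    linarith
  have hF6 : ∀ j, Ft 6 j = 0 := fun j => rfl
  have hF7 : ∀ j, Ft 7 j = 0 := fun j => rfl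
  have hZ6 : ∀ i, Z i 6 = 0 := fun i => by
    simp only [Z, Matrix.mul_apply (N := Ftᵀ), Matrix.transpose_apply, hF6, mul_zero, Finset.sum_const_zero]
  have hZ7 : ∀ i, Z i 7 = 0 := fun i => by
    simp only [Z, Matrix.mul_apply (N := Ftᵀ), Matrix.transpose_apply, hF7, mul_zero, Finset.sum_const_zero]
  have hp : ∀ i, (∑ j, Z i j) % 2 = 0 := by
    intro i
    have e1 : ∑ j, Z i j = ∑ k, (Ft * G * M * G) i k * ∑ j, Ft j k := by
      simp only [Z, Matrix.mul_apply (N := Ftᵀ), Matrix.transpose_apply, Finset.mul_sum]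
      exact Finset.sum_comm
    have e2 : ∀ j, ∑ k, (Ft * G * M * G) i k * K2 j k = 0 := by
      intro j
      have : ∑ k, (Ft * G * M * G) i k * K2 j k = ((Ft * G) * (M * G * K2ᵀ)) i j := by
        simp only [← Matrix.mul_assoc]
        rw [Matrix.mul_apply (N := K2ᵀ)]; rfl
      rw [this, hK]; simp
    rw [e1]
    simp only [F_one, sp_even, mul_add, mul_left_comm _ (2 : ℤ), mul_left_comm _ (3 : ℤ),
      Finset.sum_add_distrib, ← Finset.mul_sum, e2]
    omega
  obtain ⟨t, htt, hA⟩ := Z_class Z hZs hZt hZ6 hZ7 hp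
  have hZf := Z_form Z hZs t htt hA
  obtain ⟨n1, n2, n3⟩ := triples_ne t htt
  have pm : ∀ i j, i ≠ j → inT t i = true → inT t j = true → Z i j ∈ [(1 : ℤ), -1] := by
    intro i j hij hi hj
    have := hA i j
    rw [triY, if_pos ⟨hij, hi, hj⟩] at this
    simp only [List.mem_cons, List.not_mem_nil, or_false]
    omega
  have i1 : inT t t.1 = true := by simp [inT]
  have i2 : inT t t.2.1 = true := by simp [inT]
  have i3 : inT t t.2.2 = true := by simp [inT]
  have hp1 := pm _ _ n1 i1 i2
  have hq1 := pm _ _ n2 i2 i3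
  have hs1 := pm _ _ n3 i1 i3
  generalize Z t.1 t.2.1 = p at *
  generalize Z t.2.1 t.2.2 = q at *
  generalize Z t.1 t.2.2 = s at *
  obtain ⟨c, hc, hn, hm, hadj, en, em⟩ := tri_root t htt p hp1 q hq1 s hs1
  refine ⟨_, hn, _, hm, hadj, ?_⟩
  generalize cd (lc c.1 c.2.1 (tA t p q) (tB t p s)) = n at *
  generalize cd (lc c.2.2.1 c.2.2.2 (tA t p q) (tB t p s)) = m at *
  apply four_cancel
  have hcol : ∀ i, Htᵀ *ᵥ (Pi.single i 1) = Ht i := by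
    intro i; ext j; simp
  have hconj : ∀ a b : V8, Htᵀ * w a b * Ht = w (Htᵀ *ᵥ a) (Htᵀ *ᵥ b) := by
    intro a b
    have := w_conj Htᵀ a b
    rwa [Matrix.transpose_transpose] at this
  rw [hM, hZf]
  simp only [Matrix.mul_add, Matrix.add_mul, Matrix.mul_smul, Matrix.smul_mul, hconj, hcol]
  have hdet := coefs_det c hc
  have hpp : p * p = 1 := by
    simp only [List.mem_cons, List.not_mem_nil, or_false] at hp1
    rcases hp1 with rfl | rfl <;> norm_num
  ext i j
  simp only [Matrix.add_apply, Matrix.smul_apply, w_apply, smul_eq_mul]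
  have x1 := en i
  have x2 := en j
  have y1 := em i
  have y2 := em j
  simp only [lc] at x1 x2 y1 y2
  have : 4 * (dec n i * dec m j - dec m i * dec n j)
      = tA t p q i * tB t p s j - tB t p s i * tA t p q j := by
    have : 4 * (dec n i * dec m j - dec m i * dec n j)
      = (2 * dec n i) * (2 * dec m j) - (2 * dec m i) * (2 * dec n j) := by ring
    rw [this, x1, x2, y1, y2]
    linear_combination (tA t p q i * tB t p s j - tB t p s i * tA t p q j) * hdet
  rw [this]
  simp only [tA, tB]
  linear_combination (q * (Ht t.2.2 i * Ht t.2.1 j - Ht t.2.1 i * Ht t.2.2 j)) * hpp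

theorem ker7 (k n : ℕ) (hk : 22343210 - n ≤ k) (hn : n ∈ pos7) (M : M8) (hs : Mᵀ = -M)
    (ht : (M * G * M * G).trace = -6) (h0 : M *ᵥ (G *ᵥ dec 23465432) = 0)
    (h1 : M *ᵥ (G *ᵥ dec n) = 0) : Good M := by
  induction k generalizing n M with
  | zero =>
    rcases pos7_raise n hn with h | ⟨i, hi, hm, he⟩
    · subst h; exact base M hs ht h0 h1
    · exfalso
      have := pos7_le _ hm
      have h10 : 0 < 10 ^ (7 - (i : ℕ)) := by positivity
      omega
  | succ k ih =>
    rcases pos7_raise n hn with h | ⟨i, hi, hm, he⟩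
    · subst h; exact base M hs ht h0 h1
    · have h10 : 0 < 10 ^ (7 - (i : ℕ)) := by positivity
      have := ih _ (by omega) hm (R i * M * (R i)ᵀ) (conj_skew hs _) (by rw [conj_tr, ht])
        (by have := conj_ker M i _ h0; rwa [R_top i hi] at this)
        (by have := conj_ker M i _ h1; rwa [he] at this)
      have := this.refl i
      rwa [conj_conj] at this

theorem ker8 (k n : ℕ) (hk : 23465432 - n ≤ k) (hn : n ∈ posN) (M : M8) (hs : Mᵀ = -M)
    (ht : (M * G * M * G).trace = -6) (h1 : M *ᵥ (G *ᵥ dec n) = 0) : Good M := by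
  have top : ∀ M : M8, Mᵀ = -M → (M * G * M * G).trace = -6 →
      M *ᵥ (G *ᵥ dec 23465432) = 0 → Good M := by
    intro M hs ht h0
    obtain ⟨n, hn, h1⟩ := exists_root7 M hs ht h0
    exact ker7 _ n le_rfl hn M hs ht h0 h1
  induction k generalizing n M with
  | zero =>
    rcases pos_raise n hn with h | ⟨i, hm, he⟩
    · subst h; exact top M hs ht h1
    · exfalso
      have := pos_le _ hm
      have h10 : 0 < 10 ^ (7 - (i : ℕ)) := by positivity
      omega
  | succ k ih =>
    rcases pos_raise n hn with h | ⟨i, hm, he⟩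
    · subst h; exact top M hs ht h1
    · have h10 : 0 < 10 ^ (7 - (i : ℕ)) := by positivity
      have := ih _ (by omega) hm (R i * M * (R i)ᵀ) (conj_skew hs _) (by rw [conj_tr, ht])
        (by have := conj_ker M i _ h1; rwa [he] at this)
      have := this.refl i
      rwa [conj_conj] at this

theorem classify (M : M8) (hs : Mᵀ = -M) (ht : (M * G * M * G).trace = -6) : Good M := by
  obtain ⟨n, hn, h1⟩ := exists_root M hs ht
  exact ker8 _ n le_rfl hn M hs ht h1

theorem Good.props {M : M8} (h : Good M) : Mᵀ = -M ∧ (M * G * M * G).trace = -6 := by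
  obtain ⟨n, hn, m, hm, hb, rfl⟩ := h
  rw [adj_iff] at hb
  refine ⟨w_skew _ _, ?_⟩
  rw [w_tr, pos_norm n hn, pos_norm m hm, bf_symm (dec m), hb]
  norm_num

theorem bf_smul_sub (x y : ℤ) (a b c : V8) : bf (x • a - y • b) c = x * bf a c - y * bf b c := by
  simp only [bf, Pi.sub_apply, Pi.smul_apply, smul_eq_mul]; ring

theorem bnd (p q : ℤ) (h : p * p + p * q + q * q = 3) : -2 ≤ p ∧ p ≤ 2 ∧ -2 ≤ q ∧ q ≤ 2 := by
  refine ⟨?_, ?_, ?_, ?_⟩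
  · nlinarith [sq_nonneg (p + 2 * q)]
  · nlinarith [sq_nonneg (p + 2 * q)]
  · nlinarith [sq_nonneg (q + 2 * p)]
  · nlinarith [sq_nonneg (q + 2 * p)]

set_option maxHeartbeats 1000000 in
theorem w_inj (a b c d : V8) (ha : bf a a = 2) (hb : bf b b = 2) (hab : bf a b = -1)
    (hc : bf c c = 2) (hd : bf d d = 2) (hcd : bf c d = -1)
    (pa : 0 < ∑ i, a i) (pb : 0 < ∑ i, b i) (pc : 0 < ∑ i, c i) (pd : 0 < ∑ i, d i)
    (h : w a b = w c d) : a = c ∧ b = d := by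
  have e1 : bf b a • a - bf a a • b = bf d a • c - bf c a • d := by
    rw [← w_mulVec, h, w_mulVec]
  have e2 : bf b b • a - bf a b • b = bf d b • c - bf c b • d := by
    rw [← w_mulVec, h, w_mulVec]
  have f1 := congrArg (fun v => bf v v) e1
  have f2 := congrArg (fun v => bf v v) e2
  have f3 := congrArg (fun v => bf v b) e1
  have f4 : bf (bf b a • a - bf a a • b) (bf b b • a - bf a b • b) =
      bf (bf d a • c - bf c a • d) (bf d b • c - bf c b • d) := by rw [e1, e2]
  rw [bf_smul_sub, bf_smul_sub, bf_symm a (_ - _), bf_symm b (_ - _), bf_symm c (_ - _),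
    bf_symm d (_ - _), bf_smul_sub, bf_smul_sub, bf_smul_sub, bf_smul_sub, bf_symm b a,
    bf_symm d c, ha, hb, hab, hc, hd, hcd] at f4
  simp only [bf_smul_sub] at f1 f2 f3
  rw [bf_symm a (_ - _), bf_symm b (_ - _), bf_symm c (_ - _), bf_symm d (_ - _)] at f1 f2
  simp only [bf_smul_sub] at f1 f2
  rw [bf_symm b a, bf_symm d c] at f1 f2
  rw [bf_symm b a] at f3
  rw [bf_symm b a] at e1
  rw [ha, hab] at e1
  rw [hb, hab] at e2
  rw [ha, hb, hab, hc, hd, hcd] at f1 f2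
  rw [ha, hb, hab] at f3
  generalize bf d a = q at *
  generalize bf c a = p at *
  generalize bf d b = s at *
  generalize bf c b = r at *
  have g1 : p * p + p * q + q * q = 3 := by linarith only [f1]
  have g2 : r * r + r * s + s * s = 3 := by linarith only [f2]
  have g3 : p * s - q * r = 3 := by linarith only [f3]
  have g4 : 2 * (q * s) + q * r + p * s + 2 * (p * r) = -3 := by linarith only [f4]
  obtain ⟨hp1, hp2, hq1, hq2⟩ := bnd p q g1
  obtain ⟨hr1, hr2, hs1, hs2⟩ := bnd r s g2
  have s1 := congrArg (fun v : V8 => ∑ i, v i) e1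
  have s2 := congrArg (fun v : V8 => ∑ i, v i) e2
  simp only [Pi.sub_apply, Pi.smul_apply, smul_eq_mul, Finset.sum_sub_distrib,
    ← Finset.mul_sum] at s1 s2
  have e1' : ∀ i, -1 * a i - 2 * b i = q * c i - p * d i := fun i => by
    simpa using congrFun e1 i
  have e2' : ∀ i, 2 * a i - -1 * b i = s * c i - r * d i := fun i => by
    simpa using congrFun e2 i
  clear e1 e2 f1 f2 f3 f4 h
  generalize ∑ i, a i = A at *
  generalize ∑ i, b i = B at *
  generalize ∑ i, c i = C at *
  generalize ∑ i, d i = D at *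
  have fin : p = 2 ∧ q = -1 ∧ r = -1 ∧ s = 2 := by
    interval_cases p <;> interval_cases q <;> (try omega) <;> interval_cases r <;>
      interval_cases s <;> omega
  obtain ⟨rfl, rfl, rfl, rfl⟩ := fin
  constructor
  · ext i; have := e1' i; have := e2' i; omega
  · ext i; have := e1' i; have := e2' i; omega

theorem dec_inj (n m : ℕ) (hn : n ∈ posN) (hm : m ∈ posN) (h : dec n = dec m) : n = m := by
  have hn := pos_le n hn
  have hm := pos_le m hm
  have h0 : ((n / 10000000 % 10 : ℕ) : ℤ) = ((m / 10000000 % 10 : ℕ) : ℤ) := congrFun h 0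
  have h1 : ((n / 1000000 % 10 : ℕ) : ℤ) = ((m / 1000000 % 10 : ℕ) : ℤ) := congrFun h 1
  have h2 : ((n / 100000 % 10 : ℕ) : ℤ) = ((m / 100000 % 10 : ℕ) : ℤ) := congrFun h 2
  have h3 : ((n / 10000 % 10 : ℕ) : ℤ) = ((m / 10000 % 10 : ℕ) : ℤ) := congrFun h 3
  have h4 : ((n / 1000 % 10 : ℕ) : ℤ) = ((m / 1000 % 10 : ℕ) : ℤ) := congrFun h 4
  have h5 : ((n / 100 % 10 : ℕ) : ℤ) = ((m / 100 % 10 : ℕ) : ℤ) := congrFun h 5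
  have h6 : ((n / 10 % 10 : ℕ) : ℤ) = ((m / 10 % 10 : ℕ) : ℤ) := congrFun h 6
  have h7 : ((n / 1 % 10 : ℕ) : ℤ) = ((m / 1 % 10 : ℕ) : ℤ) := congrFun h 7
  omega

theorem pairs_nodup : pairs.Nodup := by
  unfold pairs
  rw [List.nodup_flatMap]
  refine ⟨fun a _ => ?_, ?_⟩
  · exact (pos_nodup.filter _).map (fun x y h => by simpa using h)
  · refine pos_nodup.imp ?_
    intro a b hab x hx hy
    simp only [List.mem_map] at hx hy
    obtain ⟨_, _, rfl⟩ := hx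
    obtain ⟨_, _, h⟩ := hy
    exact hab (by simpa using (congrArg Prod.fst h).symm)

theorem mem_pairs (p : ℕ × ℕ) : p ∈ pairs ↔ p.1 ∈ posN ∧ p.2 ∈ posN ∧ adj p.1 p.2 = true := by
  obtain ⟨a, b⟩ := p
  simp only [pairs, List.mem_flatMap, List.mem_map, List.mem_filter, Prod.mk.injEq]
  constructor
  · rintro ⟨a', ha, b', ⟨hb, h⟩, rfl, rfl⟩
    exact ⟨ha, hb, h⟩
  · rintro ⟨ha, hb, h⟩
    exact ⟨a, ha, b, ⟨hb, h⟩, rfl, rfl⟩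

theorem count : Set.ncard {M : M8 | Mᵀ = -M ∧ (M * G * M * G).trace = -6} = 2240 := by
  have e : {M : M8 | Mᵀ = -M ∧ (M * G * M * G).trace = -6}
      = (fun p : ℕ × ℕ => w (dec p.1) (dec p.2)) '' (pairs.toFinset : Set (ℕ × ℕ)) := by
    ext M
    constructor
    · rintro ⟨h1, h2⟩
      obtain ⟨n, hn, m, hm, hb, rfl⟩ := classify M h1 h2
      exact ⟨(n, m), by simp [mem_pairs, hn, hm, hb], rfl⟩
    · rintro ⟨p, hp, rfl⟩
      have hp : p ∈ pairs := by simpa using hp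
      rw [mem_pairs] at hp
      exact Good.props ⟨_, hp.1, _, hp.2.1, hp.2.2, rfl⟩
  rw [e, Set.ncard_image_of_injOn, Set.ncard_coe_finset, List.toFinset_card_of_nodup pairs_nodup,
    pairs_length]
  intro p hp q hq h
  have hp : p ∈ pairs := by simpa using hp
  have hq : q ∈ pairs := by simpa using hq
  rw [mem_pairs] at hp hq
  obtain ⟨p1, p2, p3⟩ := hp
  obtain ⟨q1, q2, q3⟩ := hq
  rw [adj_iff] at p3 q3
  have := w_inj _ _ _ _ (pos_norm _ p1) (pos_norm _ p2) p3 (pos_norm _ q1) (pos_norm _ q2) q3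
    (pos_ht _ p1) (pos_ht _ p2) (pos_ht _ q1) (pos_ht _ q2) h
  exact Prod.ext (dec_inj _ _ p1 q1 this.1) (dec_inj _ _ p2 q2 this.2)

/-! ### The exterior square -/

def wAlt : V8 [⋀^Fin 2]→ₗ[ℤ] M8 where
  toFun v := w (v 0) (v 1)
  map_update_add' v i x y := by
    ext k l
    fin_cases i <;> simp [w_apply, Function.update] <;> ring
  map_update_smul' v i c x := by
    ext k l
    fin_cases i <;> simp [w_apply, Function.update] <;> ring
  map_eq_zero_of_eq' v i j h hij := by
    have : v 0 = v 1 := by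
      fin_cases i <;> fin_cases j <;> simp_all
    ext k l
    simp [w_apply, this]

noncomputable def toM : (⋀[ℤ]^2 V8) →ₗ[ℤ] M8 := exteriorPower.alternatingMapLinearEquiv wAlt

theorem toM_wedge (a : Fin 2 → V8) : toM (exteriorPower.ιMulti ℤ 2 a) = w (a 0) (a 1) :=
  exteriorPower.alternatingMapLinearEquiv_apply_ιMulti _ _

noncomputable def back : M8 →ₗ[ℤ] (⋀[ℤ]^2 V8) where
  toFun M := ∑ i, ∑ j, if i < j then M i j •
    exteriorPower.ιMulti ℤ 2 ![(Pi.single i 1 : V8), Pi.single j 1] else 0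
  map_add' M N := by
    simp only [← Finset.sum_add_distrib]
    refine Finset.sum_congr rfl fun i _ => Finset.sum_congr rfl fun j _ => ?_
    split_ifs <;> simp [add_smul]
  map_smul' c M := by
    simp only [Finset.smul_sum]
    refine Finset.sum_congr rfl fun i _ => Finset.sum_congr rfl fun j _ => ?_
    split_ifs <;> simp [mul_smul]

theorem wedge_swap (a b : V8) : exteriorPower.ιMulti ℤ 2 ![b, a]
    = - exteriorPower.ιMulti ℤ 2 ![a, b] := by
  have := (exteriorPower.ιMulti ℤ 2 (M := V8)).map_swap ![a, b] (i := 0) (j := 1) (by decide)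
  rw [← this]
  congr 1
  ext i
  fin_cases i <;> simp

theorem back_w (i j : Fin 8) (h : i < j) : back (w (Pi.single i 1) (Pi.single j 1))
    = exteriorPower.ιMulti ℤ 2 ![(Pi.single i 1 : V8), Pi.single j 1] := by
  change (∑ a, ∑ b, if a < b then (w (Pi.single i 1) (Pi.single j 1)) a b •
    exteriorPower.ιMulti ℤ 2 ![(Pi.single a 1 : V8), Pi.single b 1] else 0) = _
  rw [Finset.sum_eq_single i, Finset.sum_eq_single j]
  · rw [if_pos h]
    simp [w_apply, h.ne, h.ne']
  · intro b _ hb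
    split_ifs with hib
    · simp [w_apply, Pi.single_apply, hb, h.ne]
    · rfl
  · simp
  · intro a _ ha
    refine Finset.sum_eq_zero fun b _ => ?_
    split_ifs with hab
    · by_cases haj : a = j
      · subst haj
        have : b ≠ i := by rintro rfl; exact absurd h (not_lt.2 hab.le)
        simp [w_apply, Pi.single_apply, ha, this]
      · simp [w_apply, Pi.single_apply, ha, haj]
    · rfl
  · simp

theorem back_toM (x : ⋀[ℤ]^2 V8) : back (toM x) = x := by
  suffices back ∘ₗ toM = LinearMap.id from LinearMap.congr_fun this x
  apply exteriorPower.linearMap_ext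
  refine Module.Basis.ext_alternating (Pi.basisFun ℤ (Fin 8)) fun v hv => ?_
  simp only [LinearMap.compAlternatingMap_apply, LinearMap.comp_apply, LinearMap.id_apply,
    toM_wedge, Pi.basisFun_apply]
  have e : (fun i => (Pi.single (v i) 1 : V8)) = ![Pi.single (v 0) 1, Pi.single (v 1) 1] := by
    ext i; fin_cases i <;> rfl
  rw [e]
  have hne : v 0 ≠ v 1 := fun h => absurd (hv h) (by decide)
  rcases lt_or_gt_of_ne hne with h | h
  · exact back_w _ _ h
  · rw [w_swap, map_neg, back_w _ _ h, wedge_swap]; simp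

theorem toM_inj : Function.Injective toM := Function.LeftInverse.injective back_toM

theorem toM_skew (x : ⋀[ℤ]^2 V8) : (toM x)ᵀ = - toM x := by
  let f : M8 →ₗ[ℤ] M8 :=
    { toFun := fun M => Mᵀ + M
      map_add' := fun M N => by simp only [Matrix.transpose_add]; abel
      map_smul' := fun c M => by
        simp only [Matrix.transpose_smul, smul_add, RingHom.id_apply] }
  suffices f ∘ₗ toM = 0 from eq_neg_of_add_eq_zero_left (LinearMap.congr_fun this x)
  apply exteriorPower.linearMap_ext
  ext1 a
  simp only [LinearMap.compAlternatingMap_apply, LinearMap.comp_apply, toM_wedge]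
  change (w (a 0) (a 1))ᵀ + w (a 0) (a 1) = 0
  rw [w_skew]; simp

theorem skew_surj (M : M8) (h : Mᵀ = -M) : toM (back M) = M := by
  have sk : ∀ i j, M j i = - M i j := fun i j => by
    have := congrFun (congrFun h i) j
    simpa using this
  have hd : ∀ i, M i i = 0 := fun i => by have := sk i i; omega
  have e : toM (back M) = ∑ a, ∑ b, if a < b then M a b • w (Pi.single a 1) (Pi.single b 1)
      else 0 := by
    change toM (∑ a, ∑ b, if a < b then M a b •
      exteriorPower.ιMulti ℤ 2 ![(Pi.single a 1 : V8), Pi.single b 1] else 0) = _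
    simp only [map_sum]
    refine Finset.sum_congr rfl fun i _ => Finset.sum_congr rfl fun j _ => ?_
    split_ifs
    · rw [map_smul, toM_wedge]; rfl
    · simp
  have hlt : ∀ i j, i < j → (toM (back M)) i j = M i j := by
    intro i j hij
    rw [e]
    simp only [Matrix.sum_apply]
    rw [Finset.sum_eq_single i, Finset.sum_eq_single j]
    · rw [if_pos hij]
      simp [w_apply, hij.ne, hij.ne']
    · intro b _ hb
      split_ifs
      · simp [w_apply, Pi.single_apply, hb.symm, hij.ne']
      · rfl
    · simp
    · intro a _ ha
      refine Finset.sum_eq_zero fun b _ => ?_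
      split_ifs with hab
      · by_cases haj : j = a
        · subst haj
          have : i ≠ b := by rintro rfl; exact absurd hij (not_lt.2 hab.le)
          simp [w_apply, Pi.single_apply, ha.symm, this]
        · simp [w_apply, Pi.single_apply, ha.symm, haj]
      · rfl
    · simp
  have hs := toM_skew (back M)
  have sk' : ∀ i j, toM (back M) j i = - toM (back M) i j := fun i j => by
    have := congrFun (congrFun hs i) j
    simpa using this
  ext i j
  rcases lt_trichotomy i j with h | h | h
  · exact hlt i j h
  · subst h
    have := sk' i i
    rw [hd]; omega
  · rw [sk', sk, hlt j i h]

noncomputable def Cf : (⋀[ℤ]^2 V8) →ₗ[ℤ] (⋀[ℤ]^2 V8) →ₗ[ℤ] ℤ :=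
  LinearMap.mk₂ ℤ (fun x y => ∑ i, ∑ j, if i < j then toM x i j * (G * toM y * G) i j else 0)
    (fun x x' y => by
      simp only [← Finset.sum_add_distrib]
      refine Finset.sum_congr rfl fun i _ => Finset.sum_congr rfl fun j _ => ?_
      split_ifs <;> simp [add_mul])
    (fun c x y => by
      simp only [Finset.smul_sum]
      refine Finset.sum_congr rfl fun i _ => Finset.sum_congr rfl fun j _ => ?_
      split_ifs
      · rw [map_smul, Matrix.smul_apply, smul_mul_assoc]
      · simp)
    (fun x y y' => by
      simp only [← Finset.sum_add_distrib]
      refine Finset.sum_congr rfl fun i _ => Finset.sum_congr rfl fun j _ => ?_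
      split_ifs
      · rw [map_add, Matrix.mul_add, Matrix.add_mul, Matrix.add_apply, mul_add]
      · simp)
    (fun c x y => by
      simp only [Finset.smul_sum]
      refine Finset.sum_congr rfl fun i _ => Finset.sum_congr rfl fun j _ => ?_
      split_ifs
      · rw [map_smul, Matrix.mul_smul, Matrix.smul_mul, Matrix.smul_apply, mul_smul_comm]
      · simp)

theorem two_sum (f : Fin 8 → Fin 8 → ℤ) (hf : ∀ i j, f i j = f j i) (h0 : ∀ i, f i i = 0) :
    2 * (∑ i, ∑ j, if i < j then f i j else 0) = ∑ i, ∑ j, f i j := by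
  have h1 : ∑ i, ∑ j, f i j = (∑ i, ∑ j, if i < j then f i j else 0)
      + ∑ i, ∑ j, if j < i then f i j else 0 := by
    simp only [← Finset.sum_add_distrib]
    refine Finset.sum_congr rfl fun i _ => Finset.sum_congr rfl fun j _ => ?_
    rcases lt_trichotomy i j with h | h | h
    · simp [h, h.not_gt]
    · subst h; simp [h0]
    · simp [h, h.not_gt]
  have h2 : (∑ i, ∑ j, if j < i then f i j else 0) = ∑ i, ∑ j, if i < j then f i j else 0 := by
    rw [Finset.sum_comm]
    refine Finset.sum_congr rfl fun i _ => Finset.sum_congr rfl fun j _ => ?_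
    rw [hf]
  rw [h1, h2]; ring

theorem two_Cf (x y : ⋀[ℤ]^2 V8) : 2 * Cf x y = - (toM x * G * toM y * G).trace := by
  have skx : ∀ i j, toM x j i = - toM x i j := fun i j => by
    have := congrFun (congrFun (toM_skew x) i) j
    simpa using this
  have hB : (G * toM y * G)ᵀ = -(G * toM y * G) := by
    simp only [Matrix.transpose_mul, G_symm, toM_skew, Matrix.mul_assoc, Matrix.neg_mul,
      Matrix.mul_neg]
  have sky : ∀ i j, (G * toM y * G) j i = - (G * toM y * G) i j := fun i j => by
    exact congrFun (congrFun hB i) j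
  change 2 * (∑ i, ∑ j, if i < j then toM x i j * (G * toM y * G) i j else 0) = _
  rw [two_sum (fun i j => toM x i j * (G * toM y * G) i j)]
  · have : (toM x * G * toM y * G) = toM x * (G * toM y * G) := by simp only [Matrix.mul_assoc]
    rw [this]
    simp only [Matrix.trace, Matrix.diag, Matrix.mul_apply (M := toM x), ← Finset.sum_neg_distrib]
    refine Finset.sum_congr rfl fun i _ => Finset.sum_congr rfl fun j _ => ?_
    rw [sky i j]; ring
  · intro i j
    rw [skx i j, sky i j]; ring
  · intro i
    have := skx i i
    have : toM x i i = 0 := by omega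
    change toM x i i * _ = 0
    rw [this, zero_mul]

theorem card_eq : Nat.card {x : ⋀[ℤ]^2 V8 // Cf x x = 3} = 2240 := by
  rw [← count]
  have : {M : M8 | Mᵀ = -M ∧ (M * G * M * G).trace = -6} = toM '' {x | Cf x x = 3} := by
    ext M
    constructor
    · rintro ⟨h1, h2⟩
      refine ⟨back M, ?_, skew_surj M h1⟩
      have := two_Cf (back M) (back M)
      rw [skew_surj M h1, h2] at this
      change Cf _ _ = 3
      omega
    · rintro ⟨x, hx, rfl⟩
      refine ⟨toM_skew x, ?_⟩
      have := two_Cf x x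
      change Cf _ _ = 3 at hx
      rw [hx] at this
      omega
  rw [this, Set.ncard_image_of_injective _ toM_inj]
  rfl

end ExtE8

/-- **Statement 17.** The lattice `Λ²(E₈)`, with the induced bilinear form
`(a₁∧a₂, b₁∧b₂) = (a₁,b₁)(a₂,b₂) − (a₁,b₂)(a₂,b₁)`, contains exactly `2240` vectors
of norm `3`. -/
theorem exterior_square_E8_norm_three_count :
    ∃ C : (⋀[ℤ]^2 (Fin 8 → ℤ)) →ₗ[ℤ] (⋀[ℤ]^2 (Fin 8 → ℤ)) →ₗ[ℤ] ℤ,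
      (∀ a b : Fin 2 → (Fin 8 → ℤ),
        C (wedge ℤ 2 a) (wedge ℤ 2 b) =
          E8form (a 0) (b 0) * E8form (a 1) (b 1)
            - E8form (a 0) (b 1) * E8form (a 1) (b 0)) ∧
      Nat.card {x : ⋀[ℤ]^2 (Fin 8 → ℤ) // C x x = 3} = 2240 := by
  refine ⟨ExtE8.Cf, ?_, ExtE8.card_eq⟩
  intro a b
  have h := ExtE8.two_Cf (wedge ℤ 2 a) (wedge ℤ 2 b)
  have e : ∀ c : Fin 2 → (Fin 8 → ℤ), ExtE8.toM (wedge ℤ 2 c) = ExtE8.w (c 0) (c 1) :=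
    fun c => ExtE8.toM_wedge c
  have f : ∀ u v : Fin 8 → ℤ, E8form u v = ExtE8.bf u v := by
    intro u v
    rw [ExtE8.bf_eq, E8form, Matrix.toLinearMap₂'_apply']
  rw [e, e, ExtE8.w_tr] at h
  simp only [f]
  linarith
end
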